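/- Weight transition through a three-dimensional saddle, second case: with the vector field ξ, the cylinder B, the map φ_x, the fence Φ̄ and the saturation as in the context, let C' ⊆ {(u,v) : u > 0, v > 0, u² + v² ≤ 1} be a subset of weight ρ' at the origin with ρ' < μ/λ, and let S' be the saturation of φ_x(C') by the ξ-flow in B. Then Φ̄⁻¹(S') is contained in ℝ²_{>0} and has weight ρ'/(μ − λρ') at the origin. -/

import Mathlib

open Filter Set

/-- A parameterized real analytic curve `c : [1,∞) → ℝ²_{>0}` with nonvanishing
derivative for `t > 1` and limit `(0,0)` at infinity. -/
def WeightCurve (c : ℝ → ℝ × ℝ) : Prop :=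
  AnalyticOnNhd ℝ c (Set.Ici 1) ∧
  (∀ t ∈ Set.Ici (1 : ℝ), 0 < (c t).1 ∧ 0 < (c t).2) ∧
  (∀ t : ℝ, 1 < t → deriv c t ≠ 0) ∧
  Tendsto c atTop (nhds (0, 0))

/-- The curve `c` has weight `ρ` at the origin:
`k₁·c₁(t)^ρ < c₂(t) < k₂·c₁(t)^ρ` for all `t > t₀`. -/
def CurveHasWeight (c : ℝ → ℝ × ℝ) (ρ : ℝ) : Prop :=
  ∃ k₁ k₂ t₀ : ℝ, 0 < k₁ ∧ k₁ < k₂ ∧ 1 < t₀ ∧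
    ∀ t : ℝ, t₀ < t → k₁ * (c t).1 ^ ρ < (c t).2 ∧ (c t).2 < k₂ * (c t).1 ^ ρ

/-- A subset `C ⊆ ℝ²_{>0}` has weight `ρ` if it is the image of a parameterized
real analytic curve of weight `ρ`. -/
def SetHasWeight (C : Set (ℝ × ℝ)) (ρ : ℝ) : Prop :=
  ∃ c : ℝ → ℝ × ℝ, WeightCurve c ∧ CurveHasWeight c ρ ∧ C = c '' Set.Ici 1

/-- The cylinder `B = {0 ≤ x ≤ 1, 0 ≤ y, 0 ≤ z, y² + z² ≤ 1}` in `ℝ³`. -/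
def Bcyl : Set (ℝ × ℝ × ℝ) :=
  {p | 0 ≤ p.1 ∧ p.1 ≤ 1 ∧ 0 ≤ p.2.1 ∧ 0 ≤ p.2.2 ∧ p.2.1 ^ 2 + p.2.2 ^ 2 ≤ 1}

/-- The saturation of `A` by the `ξ`-flow in `B`: points lying on an integral curve
of `ξ` contained in `B` that starts or ends in `A`. -/
def Saturation (ξ : ℝ × ℝ × ℝ → ℝ × ℝ × ℝ) (A : Set (ℝ × ℝ × ℝ)) : Set (ℝ × ℝ × ℝ) :=
  {p | ∃ s₀ s₁ : ℝ, s₀ ≤ s₁ ∧ ∃ γ : ℝ → ℝ × ℝ × ℝ,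
    (∀ τ ∈ Set.Icc s₀ s₁, γ τ ∈ Bcyl) ∧
    (∀ τ ∈ Set.Icc s₀ s₁, HasDerivAt γ (ξ (γ τ)) τ) ∧
    (∃ s ∈ Set.Icc s₀ s₁, γ s = p) ∧
    (γ s₀ ∈ A ∨ γ s₁ ∈ A)}

/-- The inclusion `φ_x(u,v) = (1,u,v)`. -/
def phiX (q : ℝ × ℝ) : ℝ × ℝ × ℝ := (1, q.1, q.2)

/-- The fence `Φ(u,v) = (v, cos(πu/2), sin(πu/2))`. -/
noncomputable def fencePhi (q : ℝ × ℝ) : ℝ × ℝ × ℝ :=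
  (q.2, Real.cos (Real.pi * q.1 / 2), Real.sin (Real.pi * q.1 / 2))

/-- The fence `Φ̄(u,v) = (v, sin(πu/2), cos(πu/2))`. -/
noncomputable def fencePhiBar (q : ℝ × ℝ) : ℝ × ℝ × ℝ :=
  (q.2, Real.sin (Real.pi * q.1 / 2), Real.cos (Real.pi * q.1 / 2))

/-- The domain `[0,1] × [0,1]` of the fences. -/
def fenceSquare : Set (ℝ × ℝ) := Set.Icc (0 : ℝ) 1 ×ˢ Set.Icc (0 : ℝ) 1

section
open Topology

variable {K E F : Type*} [TopologicalSpace K] [CompactSpace K]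
  [NormedAddCommGroup E] [NormedSpace ℝ E] [NormedAddCommGroup F] [NormedSpace ℝ F]

/-- The pointwise action of a continuous multilinear map on spaces of continuous functions. -/
noncomputable def pointwiseMultilinear (K : Type*) [TopologicalSpace K] [CompactSpace K] {n : ℕ}
    (m : ContinuousMultilinearMap ℝ (fun _ : Fin n => E) F) :
    ContinuousMultilinearMap ℝ (fun _ : Fin n => C(K, E)) C(K, F) :=
  MultilinearMap.mkContinuous
    { toFun := fun h => ⟨fun k => m fun i => h i k, by fun_prop⟩
      map_update_add' := by
        intro _ h i x y
        ext k
        have key : ∀ z : C(K, E), (fun j => Function.update h i z j k)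
            = Function.update (fun j => h j k) i (z k) := by
          intro z; ext j
          by_cases hj : j = i
          · subst hj; simp
          · simp [hj]
        simp only [ContinuousMap.coe_mk, ContinuousMap.add_apply]
        rw [key, key, key]
        simp
      map_update_smul' := by
        intro _ h i c x
        ext k
        have key : ∀ z : C(K, E), (fun j => Function.update h i z j k)
            = Function.update (fun j => h j k) i (z k) := by
          intro z; ext j
          by_cases hj : j = i
          · subst hj; simp
          · simp [hj]
        simp only [ContinuousMap.coe_mk, ContinuousMap.smul_apply]
        rw [key, key]
        simp }
    ‖m‖ (by
      intro h
      refine (ContinuousMap.norm_le _ (by positivity)).2 fun k => ?_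
      refine (m.le_opNorm _).trans ?_
      gcongr with i
      exact (h i).norm_coe_le_norm k)

theorem norm_pointwiseMultilinear_le {n : ℕ}
    (m : ContinuousMultilinearMap ℝ (fun _ : Fin n => E) F) :
    ‖pointwiseMultilinear K m‖ ≤ ‖m‖ :=
  MultilinearMap.mkContinuous_norm_le _ (norm_nonneg _) _

/-- The superposition operator of an analytic function is analytic at constant functions. -/
theorem analyticAt_superposition [CompleteSpace F] (f : C(E, F)) {q : E} (hf : AnalyticAt ℝ f q) :
    AnalyticAt ℝ (fun γ : C(K, E) => f.comp γ) (ContinuousMap.const K q) := by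
  obtain ⟨p, r, hp⟩ := hf
  let P : FormalMultilinearSeries ℝ C(K, E) C(K, F) := fun n => pointwiseMultilinear K (p n)
  have hrP : r ≤ P.radius :=
    hp.r_le.trans (FormalMultilinearSeries.radius_le_of_le fun n => norm_pointwiseMultilinear_le _)
  refine ⟨P, r, hrP, hp.r_pos, fun {y} hy => ?_⟩
  have hs : HasSum (fun n => P n fun _ => y) (P.sum y) :=
    P.hasSum (Metric.eball_subset_eball hrP hy)
  suffices f.comp (ContinuousMap.const K q + y) = P.sum y by
    rw [this]; exact hs
  ext k
  have h1 := hs.mapL (ContinuousMap.evalCLM ℝ k : C(K, F) →L[ℝ] F)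
  have hyk : y k ∈ Metric.eball (0 : E) r := by
    rw [Metric.mem_eball, edist_zero_right] at hy ⊢
    refine lt_of_le_of_lt ?_ hy
    simpa [enorm_eq_nnnorm] using (show ‖y k‖₊ ≤ ‖y‖₊ from y.norm_coe_le_norm k)
  exact (hp.hasSum hyk).unique h1

end

section
open Topology unitInterval

variable {E : Type*} [NormedAddCommGroup E] [NormedSpace ℝ E] [CompleteSpace E]

/-- The Volterra operator `γ ↦ ∫₀ γ` on continuous functions on the unit interval. -/
noncomputable def volterra (E : Type*) [NormedAddCommGroup E] [NormedSpace ℝ E] :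
    C(I, E) →L[ℝ] C(I, E) :=
  LinearMap.mkContinuous
    { toFun := fun γ =>
        ⟨fun τ => ∫ s in (0 : ℝ)..τ, γ (projIcc 0 1 zero_le_one s),
          (intervalIntegral.continuous_primitive
            (fun _ _ => Continuous.intervalIntegrable (by fun_prop) _ _) 0).comp
              continuous_subtype_val⟩
      map_add' := fun γ δ => by
        ext τ
        exact intervalIntegral.integral_add (Continuous.intervalIntegrable (by fun_prop) _ _)
          (Continuous.intervalIntegrable (by fun_prop) _ _)
      map_smul' := fun c γ => by
        ext τ
        exact intervalIntegral.integral_smul _ _ }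
    1 (by
      intro γ
      refine (ContinuousMap.norm_le _ (by positivity)).2 fun τ => ?_
      refine (intervalIntegral.norm_integral_le_of_norm_le_const
        (fun s _ => γ.norm_coe_le_norm (projIcc 0 1 zero_le_one s))).trans ?_
      have h0 := τ.2.1
      have h1 := τ.2.2
      rw [sub_zero, abs_of_nonneg h0, one_mul]
      exact mul_le_of_le_one_right (norm_nonneg _) h1)

/-- The embedding of a space into continuous functions on the unit interval, as constants. -/
noncomputable def constUnitInterval (E : Type*) [NormedAddCommGroup E] [NormedSpace ℝ E] :
    E →L[ℝ] C(I, E) :=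
  LinearMap.mkContinuous
    { toFun := ContinuousMap.const I
      map_add' := fun _ _ => rfl
      map_smul' := fun _ _ => rfl }
    1 (fun x => (ContinuousMap.norm_le _ (by positivity)).2 fun _ => by rw [one_mul]; exact le_rfl)

omit [CompleteSpace E] in
theorem constUnitInterval_apply (x : E) : constUnitInterval E x = ContinuousMap.const I x := rfl

/-- The flow of a bounded continuous vector field is jointly analytic at `(0, q)` if the
vector field is analytic at `q`. -/
theorem analyticAt_flow_zero {X : C(E, E)} {M : ℝ} (hM : ∀ p, ‖X p‖ ≤ M) {θ : ℝ → E → E}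
    (h0 : ∀ p, θ 0 p = p) (hd : ∀ p s, HasDerivAt (fun s => θ s p) (X (θ s p)) s)
    {q : E} (hX : AnalyticAt ℝ X q) :
    AnalyticAt ℝ (fun w : ℝ × E => θ w.1 w.2) (0, q) := by
  let F : (ℝ × E) × C(I, E) → C(I, E) := fun w =>
    w.2 - constUnitInterval E w.1.2 - w.1.1 • volterra E (X.comp w.2)
  let u : (ℝ × E) × C(I, E) := ((0, q), ContinuousMap.const I q)
  have hFa : AnalyticAt ℝ F u := by
    have h1 : AnalyticAt ℝ (fun w : (ℝ × E) × C(I, E) => X.comp w.2) u :=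
      AnalyticAt.fun_comp (g := fun γ : C(I, E) => X.comp γ) (analyticAt_superposition X hX)
        analyticAt_snd
    have h2 : AnalyticAt ℝ (fun w : (ℝ × E) × C(I, E) => volterra E (X.comp w.2)) u :=
      ((volterra E).analyticAt _).fun_comp h1
    have h3 : AnalyticAt ℝ (fun w : (ℝ × E) × C(I, E) => constUnitInterval E w.1.2) u :=
      ((constUnitInterval E).analyticAt _).fun_comp (analyticAt_snd.fun_comp analyticAt_fst)
    exact (analyticAt_snd.sub h3).sub ((analyticAt_fst.fun_comp analyticAt_fst).smul h2)
  have cdf : ContDiffAt ℝ ⊤ F u := hFa.contDiffAt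
  have hFu : F u = 0 := by
    simp only [F, u, constUnitInterval_apply, zero_smul, sub_self]
  have hpart : fderiv ℝ F u ∘L .inr ℝ (ℝ × E) C(I, E) = ContinuousLinearMap.id ℝ C(I, E) := by
    have h1 : HasFDerivAt (fun γ : C(I, E) => F ((0, q), γ))
        (fderiv ℝ F u ∘L .inr ℝ (ℝ × E) C(I, E)) (ContinuousMap.const I q) :=
      HasFDerivAt.comp (g := F) (f := fun γ : C(I, E) => (((0, q), γ) : (ℝ × E) × C(I, E)))
        (ContinuousMap.const I q) hFa.differentiableAt.hasFDerivAt (hasFDerivAt_prodMk_right _ _)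
    have h2 : HasFDerivAt (fun γ : C(I, E) => F ((0, q), γ))
        (ContinuousLinearMap.id ℝ C(I, E)) (ContinuousMap.const I q) := by
      have : (fun γ : C(I, E) => F ((0, q), γ)) = fun γ => γ - constUnitInterval E q := by
        ext1 γ
        simp only [F, zero_smul, sub_zero]
      rw [this]
      exact (hasFDerivAt_id _).sub_const _
    exact h1.unique h2
  have hinv : (fderiv ℝ F u ∘L .inr ℝ (ℝ × E) C(I, E)).IsInvertible := by
    rw [hpart]; exact ⟨ContinuousLinearEquiv.refl ℝ _, rfl⟩
  have hθc : ∀ p, Continuous fun s => θ s p := fun p =>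
    continuous_iff_continuousAt.2 fun s => (hd p s).continuousAt
  let Γ : ℝ × E → C(I, E) := fun w =>
    ⟨fun τ => θ (w.1 * τ) w.2, (hθc w.2).comp (by fun_prop)⟩
  have hdist : ∀ s p, ‖θ s p - p‖ ≤ M * |s| := by
    intro s p
    have := Convex.norm_image_sub_le_of_norm_hasDerivWithin_le (f := fun s => θ s p)
      (f' := fun s => X (θ s p)) (s := univ) (C := M) (x := 0) (y := s)
      (fun t _ => (hd p t).hasDerivWithinAt) (fun t _ => hM _) convex_univ trivial trivial
    simpa [h0] using this

  have hΓF : ∀ w, F (w, Γ w) = 0 := by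
    intro w
    ext τ
    have hi : ∫ s in (0 : ℝ)..τ, X (θ (w.1 * (projIcc 0 1 zero_le_one s : I)) w.2)
        = ∫ s in (0 : ℝ)..τ, X (θ (w.1 * s) w.2) := by
      refine intervalIntegral.integral_congr fun s hs => ?_
      rw [uIcc_of_le τ.2.1] at hs
      have : projIcc (0 : ℝ) 1 zero_le_one s = ⟨s, hs.1, hs.2.trans τ.2.2⟩ :=
        projIcc_of_mem _ _
      simp only [this]
    have hint : ∫ s in (0 : ℝ)..τ, w.1 • X (θ (w.1 * s) w.2) = θ (w.1 * τ) w.2 - w.2 := by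
      have := intervalIntegral.integral_eq_sub_of_hasDerivAt (a := 0) (b := (τ : ℝ))
        (f := fun s => θ (w.1 * s) w.2) (f' := fun s => w.1 • X (θ (w.1 * s) w.2))
        (fun s _ => by
          have h := (hd w.2 (w.1 * s)).scomp s ((hasDerivAt_id s).const_mul w.1)
          simpa [Function.comp_def] using h)
        (Continuous.intervalIntegrable (by
          have := hθc w.2
          fun_prop) _ _)
      simpa [h0] using this
    rw [intervalIntegral.integral_smul] at hint
    change θ (w.1 * τ) w.2 - w.2 - w.1 • (∫ s in (0 : ℝ)..τ,
      X (θ (w.1 * (projIcc 0 1 zero_le_one s : I)) w.2)) = 0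
    rw [hi, hint, sub_self]
  have hΓt : Tendsto Γ (𝓝 (0, q)) (𝓝 (ContinuousMap.const I q)) := by
    rw [tendsto_iff_norm_sub_tendsto_zero]
    have hb : ∀ w : ℝ × E, ‖Γ w - ContinuousMap.const I q‖ ≤ M * |w.1| + ‖w.2 - q‖ := by
      intro w
      have hM0 : 0 ≤ M := (norm_nonneg _).trans (hM q)
      refine (ContinuousMap.norm_le _ (by positivity)).2 fun τ => ?_
      change ‖θ (w.1 * τ) w.2 - q‖ ≤ _
      calc ‖θ (w.1 * τ) w.2 - q‖ ≤ ‖θ (w.1 * τ) w.2 - w.2‖ + ‖w.2 - q‖ :=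
            norm_sub_le_norm_sub_add_norm_sub _ _ _
        _ ≤ M * |w.1 * τ| + ‖w.2 - q‖ := by gcongr; exact hdist _ _
        _ ≤ M * |w.1| + ‖w.2 - q‖ := by
            rw [abs_mul, abs_of_nonneg τ.2.1]
            gcongr
            exact mul_le_of_le_one_right (abs_nonneg _) τ.2.2
    refine squeeze_zero (fun _ => norm_nonneg _) hb ?_
    have : Continuous fun w : ℝ × E => M * |w.1| + ‖w.2 - q‖ := by fun_prop
    simpa using this.tendsto (0, q)
  have hev := cdf.eventually_apply_eq_iff_implicitFunction (by simp) hinv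
  have htend : Tendsto (fun w => (w, Γ w)) (𝓝 (0, q)) (𝓝 u) := by
    exact tendsto_id.prodMk_nhds hΓt
  have hψ := (cdf.contDiffAt_implicitFunction (by simp) hinv).analyticAt
  have hval : (fun w : ℝ × E => θ w.1 w.2) =ᶠ[𝓝 (0, q)] fun w =>
      ContinuousMap.evalCLM ℝ (1 : I) (cdf.implicitFunction (by simp) hinv w) := by
    filter_upwards [htend.eventually hev] with w hw
    rw [hFu] at hw
    rw [hw.1 (hΓF w)]
    simp [Γ]
  exact (((ContinuousMap.evalCLM ℝ (1 : I) : C(I, E) →L[ℝ] E).analyticAt _).fun_comp hψ).congr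
    hval.symm
end

section
open Topology unitInterval

variable {E : Type*} [NormedAddCommGroup E] [NormedSpace ℝ E] [CompleteSpace E]

/-- A bounded Lipschitz vector field has a global flow. -/
theorem exists_global_flow {X : E → E} {K : NNReal} (hK : LipschitzWith K X) {M : ℝ}
    (hM : ∀ p, ‖X p‖ ≤ M) :
    ∃ θ : ℝ → E → E, (∀ p, θ 0 p = p) ∧
      ∀ p s, HasDerivAt (fun s => θ s p) (X (θ s p)) s := by
  have hloc : ∀ (p : E) (T : ℝ), 0 < T → ∃ α : ℝ → E, α 0 = p ∧
      ∀ t ∈ Ioo (-T) T, HasDerivAt α (X (α t)) t := by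
    intro p T hT
    have hM0 : 0 ≤ M := (norm_nonneg _).trans (hM p)
    lift M to NNReal using hM0
    lift T to NNReal using hT.le
    have hpl : IsPicardLindelof (fun _ => X) (tmin := -T) (tmax := T)
        ⟨0, by simp, by simp⟩ p (M * T) 0 M K :=
      .of_time_independent (fun x _ => hM x) hK.lipschitzOnWith (by simp)
    obtain ⟨α, hα0, hα⟩ := hpl.exists_eq_forall_mem_Icc_hasDerivWithinAt₀
    exact ⟨α, hα0, fun t ht => (hα t (Ioo_subset_Icc_self ht)).hasDerivAt
      (Icc_mem_nhds ht.1 ht.2)⟩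
  choose! α hα0 hα using hloc
  have hpos : ∀ s : ℝ, 0 < |s| + 1 := fun s => by positivity
  have heq : ∀ p S T s, 0 < S → S ≤ T → |s| < S → α p S s = α p T s := by
    intro p S T s hS hST hs
    have hT := hS.trans_le hST
    refine ODE_solution_unique_of_mem_Ioo (v := fun _ => X) (s := fun _ => univ) (K := K)
      (t₀ := 0) (a := -S) (b := S) (fun _ _ => hK.lipschitzOnWith) ⟨by linarith, hS⟩
      (fun t ht => ⟨hα p S hS t ht, trivial⟩)
      (fun t ht => ⟨hα p T hT t ⟨by linarith [ht.1], by linarith [ht.2]⟩, trivial⟩)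
      (by rw [hα0 p S hS, hα0 p T hT]) (abs_lt.1 hs)
  refine ⟨fun s p => α p (|s| + 1) s, fun p => hα0 p _ (hpos 0), fun p s => ?_⟩
  have hev : (fun t => α p (|t| + 1) t) =ᶠ[𝓝 s] α p (|s| + 2) := by
    have : ∀ᶠ t in 𝓝 s, |t| < |s| + 1 :=
      (continuous_abs.tendsto s).eventually (gt_mem_nhds (by linarith))
    filter_upwards [this] with t ht
    exact heq p _ _ t (hpos t) (by linarith) (by linarith)
  change HasDerivAt (fun s => α p (|s| + 1) s) (X (α p (|s| + 1) s)) s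
  refine HasDerivAt.congr_of_eventuallyEq ?_ hev
  rw [heq p (|s| + 1) (|s| + 2) s (hpos s) (by linarith) (by linarith)]
  exact hα p _ (by positivity) s (abs_lt.1 (by linarith))

omit [CompleteSpace E] in
theorem flow_unique {X : E → E} {K : NNReal} (hK : LipschitzWith K X) {θ : ℝ → E → E}
    (h0 : ∀ p, θ 0 p = p) (hd : ∀ p s, HasDerivAt (fun s => θ s p) (X (θ s p)) s)
    {γ : ℝ → E} (hγ : ∀ s, HasDerivAt γ (X (γ s)) s) (s : ℝ) : γ s = θ s (γ 0) :=
  congrFun (ODE_solution_unique_univ (v := fun _ => X) (s := fun _ => univ) (K := K) (t₀ := 0)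
    (fun _ => hK.lipschitzOnWith) (fun t => ⟨hγ t, trivial⟩) (fun t => ⟨hd (γ 0) t, trivial⟩)
    (h0 _).symm) s

omit [CompleteSpace E] in
theorem flow_add {X : E → E} {K : NNReal} (hK : LipschitzWith K X) {θ : ℝ → E → E}
    (h0 : ∀ p, θ 0 p = p) (hd : ∀ p s, HasDerivAt (fun s => θ s p) (X (θ s p)) s)
    (s t : ℝ) (p : E) : θ (s + t) p = θ s (θ t p) := by
  have := flow_unique hK h0 hd (γ := fun s => θ (s + t) p)
    (fun s => (hd p (s + t)).comp_add_const s t) s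
  simpa using this

/-- The flow is jointly analytic at `(T, p)` if the vector field is analytic along the
orbit segment from `p` to its image at time `T`. -/
theorem analyticAt_flow {X : E → E} {K : NNReal} (hK : LipschitzWith K X) {M : ℝ}
    (hM : ∀ p, ‖X p‖ ≤ M) {θ : ℝ → E → E}
    (h0 : ∀ p, θ 0 p = p) (hd : ∀ p s, HasDerivAt (fun s => θ s p) (X (θ s p)) s)
    {p : E} {T : ℝ} (hX : ∀ s ∈ uIcc 0 T, AnalyticAt ℝ X (θ s p)) :
    AnalyticAt ℝ (fun w : ℝ × E => θ w.1 w.2) (T, p) := by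
  have hloc : ∀ s ∈ uIcc 0 T, AnalyticAt ℝ (fun w : ℝ × E => θ w.1 w.2) (0, θ s p) :=
    fun s hs => analyticAt_flow_zero (X := ⟨X, hK.continuous⟩) hM h0 hd (hX s hs)
  let A : Set ℝ := {s | AnalyticAt ℝ (fun w : ℝ × E => θ w.1 w.2) (s, p)}
  have hAo : IsOpen A :=
    (isOpen_analyticAt ℝ (fun w : ℝ × E => θ w.1 w.2)).preimage
      (by fun_prop : Continuous fun s : ℝ => (s, p))
  have h0mem : (0 : ℝ) ∈ uIcc 0 T := left_mem_uIcc
  have hsub : uIcc 0 T ⊆ A := by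
    refine isPreconnected_uIcc.subset_of_closure_inter_subset hAo
      ⟨0, h0mem, by simpa [A, h0] using hloc 0 h0mem⟩ ?_
    rintro s ⟨hsc, hs⟩
    have hcont : ContinuousAt (fun t => (s - t, θ t p)) s := by
      have := (hd p s).continuousAt
      fun_prop
    have hev : ∀ᶠ t in 𝓝 s, AnalyticAt ℝ (fun w : ℝ × E => θ w.1 w.2) (s - t, θ t p) := by
      refine hcont.eventually ?_
      change ∀ᶠ y in 𝓝 (s - s, θ s p), AnalyticAt ℝ (fun w : ℝ × E => θ w.1 w.2) y
      rw [sub_self]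
      exact (hloc s hs).eventually_analyticAt
    obtain ⟨t, htA, ht⟩ := ((mem_closure_iff_frequently.1 hsc).and_eventually hev).exists
    have h1 : AnalyticAt ℝ (fun w : ℝ × E => θ t w.2) (s, p) :=
      AnalyticAt.fun_comp (g := fun w : ℝ × E => θ w.1 w.2) (f := fun w : ℝ × E => (t, w.2)) htA
        (analyticAt_const.prod analyticAt_snd)
    have h2 : AnalyticAt ℝ (fun w : ℝ × E => θ (w.1 - t) (θ t w.2)) (s, p) :=
      AnalyticAt.fun_comp (g := fun w : ℝ × E => θ w.1 w.2)
        (f := fun w : ℝ × E => (w.1 - t, θ t w.2)) ht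
        ((analyticAt_fst.sub analyticAt_const).prod h1)
    change AnalyticAt ℝ (fun w : ℝ × E => θ w.1 w.2) (s, p)
    simpa only [← flow_add hK h0 hd, sub_add_cancel] using h2
  exact hsub right_mem_uIcc
end

section
open Topology

/-- Orbits of a flow `θ` of a global vector field `(α x, β y, γ z)` on `ℝ³` that agrees with `ξ`
on the cylinder and that is still dissipative in the `(y, z)`-directions outside of it. -/
structure IsCutoffFlow (ξ : ℝ × ℝ × ℝ → ℝ × ℝ × ℝ) (α β γ : ℝ × ℝ × ℝ → ℝ)
    (θ : ℝ → ℝ × ℝ × ℝ → ℝ × ℝ × ℝ) : Prop where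
  continuous_α : Continuous α
  continuous_β : Continuous β
  continuous_γ : Continuous γ
  α_nonneg : ∀ p, 0 ≤ α p
  radial_nonpos : ∀ p : ℝ × ℝ × ℝ, 0 < p.1 → p.1 ≤ 1 → 0 < p.2.1 → 0 < p.2.2 →
    β p * p.2.1 ^ 2 + γ p * p.2.2 ^ 2 ≤ 0
  α_pos : ∀ p ∈ Bcyl, 0 < α p
  radial_neg : ∀ p ∈ Bcyl, 0 < p.2.1 ^ 2 + p.2.2 ^ 2 → β p * p.2.1 ^ 2 + γ p * p.2.2 ^ 2 < 0
  zero : ∀ p, θ 0 p = p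
  add : ∀ s t p, θ (s + t) p = θ s (θ t p)
  hasDerivAt : ∀ p s, HasDerivAt (fun s => θ s p)
    (α (θ s p) * (θ s p).1, β (θ s p) * (θ s p).2.1, γ (θ s p) * (θ s p).2.2) s
  eq_on : ∀ p ∈ Bcyl, ξ p = (α p * p.1, β p * p.2.1, γ p * p.2.2)
  eq_flow : ∀ (δ : ℝ → ℝ × ℝ × ℝ) (s₀ s₁ : ℝ), (∀ τ ∈ Icc s₀ s₁, δ τ ∈ Bcyl) →
    (∀ τ ∈ Icc s₀ s₁, HasDerivAt δ (ξ (δ τ)) τ) → ∀ τ ∈ Icc s₀ s₁, δ τ = θ (τ - s₀) (δ s₀)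
  analyticAt : ∀ p T, (∀ s ∈ uIcc 0 T, θ s p ∈ Bcyl) →
    AnalyticAt ℝ (fun w : ℝ × ℝ × ℝ × ℝ => θ w.1 w.2) (T, p)

theorem isClosed_Bcyl : IsClosed Bcyl := by
  unfold Bcyl
  simp only [ofPred_and]
  refine (isClosed_le ?_ ?_).inter ((isClosed_le ?_ ?_).inter ((isClosed_le ?_ ?_).inter
    ((isClosed_le ?_ ?_).inter (isClosed_le ?_ ?_)))) <;> fun_prop

theorem isCompact_Bcyl : IsCompact Bcyl := by
  refine (isCompact_Icc : IsCompact (Icc ((0 : ℝ), (0 : ℝ), (0 : ℝ)) (1, 1, 1))).of_isClosed_subset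
    isClosed_Bcyl ?_
  rintro ⟨x, y, z⟩ ⟨h1, h2, h3, h4, h5⟩
  simp only at h1 h2 h3 h4 h5
  refine ⟨⟨h1, h3, h4⟩, h2, ?_, ?_⟩ <;> simp only <;> nlinarith

theorem contDiff_mul_of_eq_zero {E : Type*} [NormedAddCommGroup E] [NormedSpace ℝ E]
    {V L : Set E} (hL : IsClosed L) (hLV : L ⊆ V) {χ f : E → ℝ}
    (hχ : ContDiff ℝ 1 χ) (h0 : ∀ p ∉ L, χ p = 0) (hf : AnalyticOnNhd ℝ f V) :
    ContDiff ℝ 1 fun p => χ p * f p := by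
  refine contDiff_iff_contDiffAt.2 fun p => ?_
  by_cases hp : p ∈ V
  · exact hχ.contDiffAt.mul (hf p hp).contDiffAt
  · refine (contDiffAt_const (c := (0 : ℝ))).congr_of_eventuallyEq ?_
    filter_upwards [hL.isOpen_compl.mem_nhds fun h => hp (hLV h)] with q hq
    rw [h0 q hq, zero_mul]

theorem exists_isCutoffFlow (lam mu : ℝ)
    (V : Set (ℝ × ℝ × ℝ)) (hVopen : IsOpen V) (hBV : Bcyl ⊆ V)
    (a b c : ℝ × ℝ × ℝ → ℝ)
    (ha : AnalyticOnNhd ℝ a V) (hb : AnalyticOnNhd ℝ b V) (hc : AnalyticOnNhd ℝ c V)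
    (ξ : ℝ × ℝ × ℝ → ℝ × ℝ × ℝ)
    (hξ : ∀ p : ℝ × ℝ × ℝ,
      ξ p = ((1 + a p) * p.1, (-lam + b p) * p.2.1, (-mu + c p) * p.2.2))
    (htrans1 : ∀ p ∈ Bcyl, 0 < 1 + a p)
    (htrans2 : ∀ p ∈ Bcyl, (p.2.1, p.2.2) ≠ ((0 : ℝ), (0 : ℝ)) →
      (-lam + b p) * p.2.1 ^ 2 + (-mu + c p) * p.2.2 ^ 2 < 0) :
    ∃ α β γ θ, IsCutoffFlow ξ α β γ θ ∧
      ∀ p ∈ Bcyl, α p = 1 + a p ∧ β p = -lam + b p ∧ γ p = -mu + c p := by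
  have ha' : AnalyticOnNhd ℝ (fun p => 1 + a p) V := fun p hp => analyticAt_const.add (ha p hp)
  have hb' : AnalyticOnNhd ℝ (fun p => -lam + b p) V := fun p hp => analyticAt_const.add (hb p hp)
  have hc' : AnalyticOnNhd ℝ (fun p => -mu + c p) V := fun p hp => analyticAt_const.add (hc p hp)
  let Q : ℝ × ℝ × ℝ → ℝ := fun p => (-lam + b p) * p.2.1 ^ 2 + (-mu + c p) * p.2.2 ^ 2
  have hQ : ContinuousOn Q V :=
    (hb'.continuousOn.mul (by fun_prop)).add (hc'.continuousOn.mul (by fun_prop))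
  let W : Set (ℝ × ℝ × ℝ) := (V ∩ (fun p => 1 + a p) ⁻¹' Ioi 0) ∩
    ({p | p.2.1 ^ 2 + p.2.2 ^ 2 < 1} ∪ (V ∩ Q ⁻¹' Iio 0))
  have hW : IsOpen W :=
    (ha'.continuousOn.isOpen_inter_preimage hVopen isOpen_Ioi).inter
      ((isOpen_lt (by fun_prop) (by fun_prop)).union
        (hQ.isOpen_inter_preimage hVopen isOpen_Iio))
  have hWV : W ⊆ V := fun p hp => hp.1.1
  have hBW : Bcyl ⊆ W := by
    refine fun p hp => ⟨⟨hBV hp, htrans1 p hp⟩, ?_⟩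
    rcases hp.2.2.2.2.lt_or_eq with h | h
    · exact Or.inl h
    · refine Or.inr ⟨hBV hp, htrans2 p hp fun h0 => ?_⟩
      simp only [Prod.mk.injEq] at h0
      norm_num [h0.1, h0.2] at h
  obtain ⟨L, hL, hBL, hLW⟩ := exists_compact_between isCompact_Bcyl hW hBW
  obtain ⟨χ, hχ1, hχ0, hχ⟩ := exists_contMDiffMap_one_nhds_of_subset_interior (n := 1)
    (modelWithCornersSelf ℝ (ℝ × ℝ × ℝ)) isClosed_Bcyl hBL
  have hχs : ContDiff ℝ 1 χ := χ.contMDiff.contDiff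
  have hα := contDiff_mul_of_eq_zero hL.isClosed (hLW.trans hWV) hχs hχ0 ha'
  have hβ := contDiff_mul_of_eq_zero hL.isClosed (hLW.trans hWV) hχs hχ0 hb'
  have hγ := contDiff_mul_of_eq_zero hL.isClosed (hLW.trans hWV) hχs hχ0 hc'
  let X : ℝ × ℝ × ℝ → ℝ × ℝ × ℝ := fun p =>
    (χ p * (1 + a p) * p.1, χ p * (-lam + b p) * p.2.1, χ p * (-mu + c p) * p.2.2)
  have hXC : ContDiff ℝ 1 X :=
    (hα.mul contDiff_fst).prodMk ((hβ.mul (contDiff_fst.comp contDiff_snd)).prodMk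
      (hγ.mul (contDiff_snd.comp contDiff_snd)))
  have hXL : HasCompactSupport X :=
    HasCompactSupport.intro hL fun p hp => by simp [X, hχ0 p hp]
  obtain ⟨K, hK⟩ := hXC.lipschitzWith_of_hasCompactSupport hXL (by norm_num)
  obtain ⟨M, hM⟩ := hXL.exists_bound_of_continuous hXC.continuous
  obtain ⟨θ, h0, hd⟩ := exists_global_flow hK hM
  have hnear : ∀ p ∈ Bcyl, ∀ᶠ q in 𝓝 p, χ q = 1 := fun p hp => hχ1.filter_mono (nhds_le_nhdsSet hp)
  have hone : ∀ p ∈ Bcyl, χ p = 1 := fun p hp => (hnear p hp).self_of_nhds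
  have hXξ : ∀ p ∈ Bcyl, ξ p = X p := fun p hp => by simp [X, hone p hp, hξ]
  have hXan : ∀ p ∈ Bcyl, AnalyticAt ℝ X p := by
    intro p hp
    have h1 : AnalyticAt ℝ (fun p : ℝ × ℝ × ℝ =>
        ((1 + a p) * p.1, (-lam + b p) * p.2.1, (-mu + c p) * p.2.2)) p :=
      ((ha' p (hBV hp)).mul analyticAt_fst).prod
        (((hb' p (hBV hp)).mul (analyticAt_fst.fun_comp analyticAt_snd)).prod
          ((hc' p (hBV hp)).mul (analyticAt_snd.fun_comp analyticAt_snd)))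
    refine h1.congr ?_
    filter_upwards [hnear p hp] with q hq
    simp [X, hq]
  refine ⟨fun p => χ p * (1 + a p), fun p => χ p * (-lam + b p), fun p => χ p * (-mu + c p), θ,
    ⟨hα.continuous, hβ.continuous, hγ.continuous, fun p => ?_, fun p hp0 hp1 hpy hpz => ?_,
      fun p hp => ?_, fun p hp hpr => ?_, h0, flow_add hK h0 hd, hd, hXξ, ?_, fun p T h => ?_⟩,
    fun p hp => by simp [hone p hp]⟩
  · by_cases hp : p ∈ L
    · exact mul_nonneg (hχ p).1 (hLW hp).1.2.le
    · simp [hχ0 p hp]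
  · have hfac : χ p * (-lam + b p) * p.2.1 ^ 2 + χ p * (-mu + c p) * p.2.2 ^ 2 = χ p * Q p := by
      simp only [Q]; ring
    rw [hfac]
    by_cases hp : p ∈ L
    · refine mul_nonpos_of_nonneg_of_nonpos (hχ p).1 ?_
      rcases (hLW hp).2 with h | h
      · exact (htrans2 p ⟨hp0.le, hp1, hpy.le, hpz.le, le_of_lt h⟩
        fun h0 => hpy.ne' (congrArg Prod.fst h0)).le
      · exact h.2.le
    · simp [hχ0 p hp]
  · simpa [hone p hp] using htrans1 p hp
  · simpa [hone p hp] using htrans2 p hp fun h0 => by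
      simp only [Prod.mk.injEq] at h0
      norm_num [h0.1, h0.2] at hpr
  · intro δ s₀ s₁ hB hδ τ hτ
    have hθ : ∀ t, HasDerivAt (fun t => θ (t - s₀) (δ s₀)) (X (θ (t - s₀) (δ s₀))) t :=
      fun t => (hd (δ s₀) (t - s₀)).comp_sub_const t s₀
    refine ODE_solution_unique (v := fun _ => X) (K := K) (a := s₀) (b := s₁) (fun _ => hK)
      (fun t ht => (hδ t ht).continuousAt.continuousWithinAt)
      (fun t ht => ?_) (fun t _ => (hθ t).continuousAt.continuousWithinAt)
      (fun t _ => (hθ t).hasDerivWithinAt) (by simp [h0]) hτ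
    rw [← hXξ _ (hB t (Ico_subset_Icc_self ht))]
    exact (hδ t (Ico_subset_Icc_self ht)).hasDerivWithinAt
  · exact analyticAt_flow hK hM h0 hd fun s hs => hXan _ (h s hs)

end

section
open Topology

theorem pos_of_hasDerivAt_mul {f g : ℝ → ℝ} (hg : Continuous g)
    (hf : ∀ s, HasDerivAt f (g s * f s) s) (h0 : 0 < f 0) (s : ℝ) : 0 < f s := by
  let G : ℝ → ℝ := fun s => ∫ t in (0 : ℝ)..s, g t
  have hG : ∀ s, HasDerivAt G (g s) s := fun s => hg.integral_hasStrictDerivAt 0 s |>.hasDerivAt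
  have hd : ∀ s, HasDerivAt (fun s => f s * Real.exp (-G s)) 0 s := fun s => by
    refine ((hf s).mul (hG s).neg.exp).congr_deriv ?_
    ring
  have hconst := is_const_of_deriv_eq_zero (fun s => (hd s).differentiableAt)
    (fun s => (hd s).deriv) s 0
  have hG0 : G 0 = 0 := intervalIntegral.integral_same
  simp only [hG0, neg_zero, Real.exp_zero, mul_one] at hconst
  exact pos_of_mul_pos_left (hconst ▸ h0) (Real.exp_pos _).le

namespace IsCutoffFlow

variable {ξ : ℝ × ℝ × ℝ → ℝ × ℝ × ℝ} {α β γ : ℝ × ℝ × ℝ → ℝ} {θ : ℝ → ℝ × ℝ × ℝ → ℝ × ℝ × ℝ}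
  (h : IsCutoffFlow ξ α β γ θ)
include h

theorem hasDerivAt_x (p : ℝ × ℝ × ℝ) (s : ℝ) :
    HasDerivAt (fun s => (θ s p).1) (α (θ s p) * (θ s p).1) s :=
  (h.hasDerivAt p s).hasFDerivAt.fst.hasDerivAt.congr_deriv (by simp)

theorem hasDerivAt_y (p : ℝ × ℝ × ℝ) (s : ℝ) :
    HasDerivAt (fun s => (θ s p).2.1) (β (θ s p) * (θ s p).2.1) s :=
  (h.hasDerivAt p s).hasFDerivAt.snd.fst.hasDerivAt.congr_deriv (by simp)

theorem hasDerivAt_z (p : ℝ × ℝ × ℝ) (s : ℝ) :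
    HasDerivAt (fun s => (θ s p).2.2) (γ (θ s p) * (θ s p).2.2) s :=
  (h.hasDerivAt p s).hasFDerivAt.snd.snd.hasDerivAt.congr_deriv (by simp)

theorem continuous_orbit (p : ℝ × ℝ × ℝ) : Continuous fun s => θ s p :=
  continuous_iff_continuousAt.2 fun s => (h.hasDerivAt p s).continuousAt

theorem x_pos {p : ℝ × ℝ × ℝ} (hp : 0 < p.1) (s : ℝ) : 0 < (θ s p).1 :=
  pos_of_hasDerivAt_mul (h.continuous_α.comp (h.continuous_orbit p)) (h.hasDerivAt_x p)
    (by simpa [h.zero] using hp) s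

theorem y_pos {p : ℝ × ℝ × ℝ} (hp : 0 < p.2.1) (s : ℝ) : 0 < (θ s p).2.1 :=
  pos_of_hasDerivAt_mul (h.continuous_β.comp (h.continuous_orbit p)) (h.hasDerivAt_y p)
    (by simpa [h.zero] using hp) s

theorem z_pos {p : ℝ × ℝ × ℝ} (hp : 0 < p.2.2) (s : ℝ) : 0 < (θ s p).2.2 :=
  pos_of_hasDerivAt_mul (h.continuous_γ.comp (h.continuous_orbit p)) (h.hasDerivAt_z p)
    (by simpa [h.zero] using hp) s

theorem x_le {p : ℝ × ℝ × ℝ} (hp : 0 < p.1) (hp1 : p.1 ≤ 1) {s : ℝ} (hs : 0 ≤ s) :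
    (θ (-s) p).1 ≤ 1 := by
  have hmono : Monotone fun s => (θ s p).1 :=
    monotone_of_hasDerivAt_nonneg (h.hasDerivAt_x p)
      fun s => mul_nonneg (h.α_nonneg _) (h.x_pos hp s).le
  refine le_trans ?_ hp1
  have := hmono (neg_nonpos.2 hs)
  simpa [h.zero] using this

omit h in
variable (θ) in
/-- The squared distance to the `x`-axis along the backward orbit of `p`. -/
def backRadius (p : ℝ × ℝ × ℝ) (s : ℝ) : ℝ := (θ (-s) p).2.1 ^ 2 + (θ (-s) p).2.2 ^ 2

omit h in
variable (β γ) in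
/-- Half the derivative of the squared distance to the `x`-axis along the flow. -/
def radialRate (p : ℝ × ℝ × ℝ) : ℝ := β p * p.2.1 ^ 2 + γ p * p.2.2 ^ 2

theorem continuous_radialRate : Continuous (radialRate β γ) :=
  (h.continuous_β.mul (by fun_prop)).add (h.continuous_γ.mul (by fun_prop))

theorem hasDerivAt_backRadius (p : ℝ × ℝ × ℝ) (s : ℝ) :
    HasDerivAt (backRadius θ p) (-2 * radialRate β γ (θ (-s) p)) s := by
  have hy := (h.hasDerivAt_y p (-s)).scomp s (hasDerivAt_neg s)
  have hz := (h.hasDerivAt_z p (-s)).scomp s (hasDerivAt_neg s)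
  refine ((hy.pow 2).add (hz.pow 2)).congr_deriv ?_
  simp [radialRate]
  ring

omit h in
/-- The point `p` lies in the cylinder and off the coordinate planes. -/
structure IsInner (p : ℝ × ℝ × ℝ) : Prop where
  x_pos : 0 < p.1
  x_le : p.1 ≤ 1
  y_pos : 0 < p.2.1
  z_pos : 0 < p.2.2
  radius_le : p.2.1 ^ 2 + p.2.2 ^ 2 ≤ 1

theorem monotoneOn_backRadius {p : ℝ × ℝ × ℝ} (hp : IsInner p) :
    MonotoneOn (backRadius θ p) (Ici 0) := by
  refine monotoneOn_of_hasDerivWithinAt_nonneg (convex_Ici 0)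
    (fun s _ => (h.hasDerivAt_backRadius p s).continuousAt.continuousWithinAt)
    (fun s _ => (h.hasDerivAt_backRadius p s).hasDerivWithinAt) fun s hs => ?_
  rw [interior_Ici] at hs
  have := h.radial_nonpos (θ (-s) p) (h.x_pos hp.x_pos _) (h.x_le hp.x_pos hp.x_le hs.le)
    (h.y_pos hp.y_pos _) (h.z_pos hp.z_pos _)
  unfold radialRate
  linarith

theorem mem_Bcyl {p : ℝ × ℝ × ℝ} (hp : IsInner p) {s : ℝ} (hs : 0 ≤ s)
    (hr : backRadius θ p s ≤ 1) : θ (-s) p ∈ Bcyl :=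
  ⟨(h.x_pos hp.x_pos _).le, h.x_le hp.x_pos hp.x_le hs, (h.y_pos hp.y_pos _).le,
    (h.z_pos hp.z_pos _).le, hr⟩

theorem mem_Bcyl_of_le {p : ℝ × ℝ × ℝ} (hp : IsInner p) {s t : ℝ} (hs : 0 ≤ s) (hst : s ≤ t)
    (hr : backRadius θ p t ≤ 1) : θ (-s) p ∈ Bcyl :=
  h.mem_Bcyl hp hs ((h.monotoneOn_backRadius hp hs (hs.trans hst) hst).trans hr)

theorem backRadius_pos {p : ℝ × ℝ × ℝ} (hp : IsInner p) (s : ℝ) : 0 < backRadius θ p s :=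
  add_pos (pow_pos (h.y_pos hp.y_pos _) 2) (pow_pos (h.z_pos hp.z_pos _) 2)

theorem radialRate_neg {p : ℝ × ℝ × ℝ} (hp : IsInner p) {s t : ℝ} (hs : 0 ≤ s) (hst : s ≤ t)
    (hr : backRadius θ p t ≤ 1) : radialRate β γ (θ (-s) p) < 0 :=
  h.radial_neg _ (h.mem_Bcyl_of_le hp hs hst hr) (h.backRadius_pos hp s)

theorem backRadius_zero (p : ℝ × ℝ × ℝ) : backRadius θ p 0 = p.2.1 ^ 2 + p.2.2 ^ 2 := by
  simp [backRadius, h.zero]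

theorem exists_exit {p : ℝ × ℝ × ℝ} (hp : IsInner p) :
    ∃ τ, 0 ≤ τ ∧ backRadius θ p τ = 1 := by
  have hcont : Continuous (backRadius θ p) :=
    continuous_iff_continuousAt.2 fun s => (h.hasDerivAt_backRadius p s).continuousAt
  obtain ⟨T, hT, hT1⟩ : ∃ T, 0 ≤ T ∧ 1 ≤ backRadius θ p T := by
    by_contra! hlt
    let K := Bcyl ∩ {q | p.2.1 ^ 2 + p.2.2 ^ 2 ≤ q.2.1 ^ 2 + q.2.2 ^ 2}
    have hK : IsCompact K := isCompact_Bcyl.inter_right (isClosed_le (by fun_prop) (by fun_prop))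
    have hmem : ∀ s, 0 ≤ s → θ (-s) p ∈ K := fun s hs => by
      refine ⟨h.mem_Bcyl hp hs (hlt s hs).le, ?_⟩
      have := h.monotoneOn_backRadius hp (mem_Ici.2 le_rfl) hs hs
      rwa [h.backRadius_zero] at this
    obtain ⟨q, hq, hmax⟩ :=
      hK.exists_isMaxOn ⟨_, hmem 0 le_rfl⟩ h.continuous_radialRate.continuousOn
    have hneg : radialRate β γ q < 0 := h.radial_neg q hq.1
      (lt_of_lt_of_le (add_pos (pow_pos hp.y_pos 2) (pow_pos hp.z_pos 2)) hq.2)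
    set ε := -radialRate β γ q with hε
    have hmono : MonotoneOn (fun s => backRadius θ p s - 2 * ε * s) (Ici 0) := by
      have hd : ∀ s, HasDerivAt (fun s => backRadius θ p s - 2 * ε * s)
          (-2 * radialRate β γ (θ (-s) p) - 2 * ε * 1) s := fun s =>
        (h.hasDerivAt_backRadius p s).sub ((hasDerivAt_id s).const_mul (2 * ε))
      refine monotoneOn_of_hasDerivWithinAt_nonneg (convex_Ici 0)
        (fun s _ => (hd s).continuousAt.continuousWithinAt)
        (fun s _ => (hd s).hasDerivWithinAt) fun s hs => ?_
      rw [interior_Ici] at hs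
      have : radialRate β γ (θ (-s) p) ≤ radialRate β γ q := hmax (hmem s hs.le)
      linarith
    have hε0 : 0 < ε := by linarith
    have h1 : (0 : ℝ) ≤ 1 / (2 * ε) := by positivity
    have h2 := hmono (mem_Ici.2 le_rfl) (mem_Ici.2 h1) h1
    have h3 := hlt _ h1
    have h4 := h.backRadius_pos hp 0
    have h5 : 2 * ε * (1 / (2 * ε)) = 1 := by field_simp
    simp only [h5] at h2
    linarith
  have h0 : backRadius θ p 0 ≤ 1 := by rw [h.backRadius_zero]; exact hp.radius_le
  obtain ⟨τ, hτ, hτ1⟩ := intermediate_value_Icc hT hcont.continuousOn ⟨h0, hT1⟩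
  exact ⟨τ, hτ.1, hτ1⟩

theorem exit_unique {p : ℝ × ℝ × ℝ} (hp : IsInner p) {s t : ℝ} (hs : 0 ≤ s) (ht : 0 ≤ t)
    (hs1 : backRadius θ p s = 1) (ht1 : backRadius θ p t = 1) : s = t := by
  have key : ∀ s t, 0 ≤ s → s < t → backRadius θ p s = 1 → backRadius θ p t = 1 → False := by
    intro s t hs hst hs1 ht1
    have hmono : StrictMonoOn (backRadius θ p) (Icc s t) := by
      refine strictMonoOn_of_hasDerivWithinAt_pos (convex_Icc s t)
        (fun r _ => (h.hasDerivAt_backRadius p r).continuousAt.continuousWithinAt)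
        (fun r _ => (h.hasDerivAt_backRadius p r).hasDerivWithinAt) fun r hr => ?_
      rw [interior_Icc] at hr
      have := h.radialRate_neg hp (hs.trans hr.1.le) hr.2.le ht1.le
      linarith
    have := hmono (left_mem_Icc.2 hst.le) (right_mem_Icc.2 hst.le) hst
    linarith
  rcases lt_trichotomy s t with hst | hst | hst
  · exact (key s t hs hst hs1 ht1).elim
  · exact hst
  · exact (key t s ht hst ht1 hs1).elim

end IsCutoffFlow
end

section
open Topology

theorem exists_analyticAt_implicit {G : ℝ × ℝ → ℝ} {t₀ s₀ g : ℝ} (hG : AnalyticAt ℝ G (t₀, s₀))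
    (hd : HasDerivAt (fun s => G (t₀, s)) g s₀) (hg : g ≠ 0) :
    ∃ ψ : ℝ → ℝ, AnalyticAt ℝ ψ t₀ ∧ ψ t₀ = s₀ ∧ ∀ᶠ t in 𝓝 t₀, G (t, ψ t) = G (t₀, s₀) := by
  have hC : ContDiffAt ℝ ⊤ G (t₀, s₀) := hG.contDiffAt
  have hinr : (fderiv ℝ G (t₀, s₀) ∘L .inr ℝ ℝ ℝ) = ContinuousLinearMap.toSpanSingleton ℝ g := by
    have h1 : HasFDerivAt (fun s : ℝ => (t₀, s)) (ContinuousLinearMap.inr ℝ ℝ ℝ) s₀ :=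
      hasFDerivAt_prodMk_right t₀ s₀
    exact (hG.differentiableAt.hasFDerivAt.comp s₀ h1).unique hd.hasFDerivAt
  have hinv : (fderiv ℝ G (t₀, s₀) ∘L .inr ℝ ℝ ℝ).IsInvertible := by
    rw [hinr]
    refine ⟨ContinuousLinearEquiv.unitsEquivAut ℝ (Units.mk0 g hg), ?_⟩
    ext
    simp
  exact ⟨hC.implicitFunction (by simp) hinv,
    (hC.contDiffAt_implicitFunction (by simp) hinv).analyticAt,
    hC.implicitFunction_apply_self (by simp) hinv,
    hC.eventually_apply_implicitFunction (by simp) hinv⟩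

/-- A function on `[1, ∞)` that locally coincides with analytic germs extends analytically. -/
theorem exists_analyticOnNhd_Ici {F : Type*} [NormedAddCommGroup F] [NormedSpace ℝ F] {f : ℝ → F}
    (hf : ∀ t₀, 1 ≤ t₀ → ∃ g, AnalyticAt ℝ g t₀ ∧ ∀ᶠ t in 𝓝 t₀, 1 ≤ t → f t = g t) :
    ∃ g, AnalyticOnNhd ℝ g (Ici 1) ∧ ∀ t, 1 ≤ t → g t = f t := by
  obtain ⟨g₁, hg₁, heq₁⟩ := hf 1 le_rfl
  refine ⟨fun t => if 1 ≤ t then f t else g₁ t, fun t₀ ht₀ => ?_, fun t ht => by simp [ht]⟩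
  rcases (mem_Ici.1 ht₀).eq_or_lt with rfl | hlt
  · refine hg₁.congr ?_
    filter_upwards [heq₁] with t ht
    split_ifs with h1
    exacts [(ht h1).symm, rfl]
  · obtain ⟨g, hg, heq⟩ := hf t₀ ht₀
    refine hg.congr ?_
    filter_upwards [heq, lt_mem_nhds hlt] with t ht h1
    rw [if_pos h1.le, ht h1.le]

namespace IsCutoffFlow

variable {ξ : ℝ × ℝ × ℝ → ℝ × ℝ × ℝ} {α β γ : ℝ × ℝ × ℝ → ℝ} {θ : ℝ → ℝ × ℝ × ℝ → ℝ × ℝ × ℝ}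
  (h : IsCutoffFlow ξ α β γ θ)
include h

theorem analyticAt_back {p : ℝ → ℝ × ℝ × ℝ} {t₀ s₀ : ℝ} (hp : AnalyticAt ℝ p t₀)
    (hin : IsInner (p t₀)) (hs₀ : 0 ≤ s₀) (hr : backRadius θ (p t₀) s₀ ≤ 1) :
    AnalyticAt ℝ (fun w : ℝ × ℝ => θ (-w.2) (p w.1)) (t₀, s₀) := by
  have h1 : AnalyticAt ℝ (fun w : ℝ × ℝ × ℝ × ℝ => θ w.1 w.2) (-s₀, p t₀) := by
    refine h.analyticAt _ _ fun s hs => ?_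
    rw [uIcc_of_ge (neg_nonpos.2 hs₀)] at hs
    rw [← neg_neg s]
    exact h.mem_Bcyl_of_le hin (by linarith [hs.2]) (by linarith [hs.1] : -s ≤ s₀) hr
  exact h1.fun_comp (f := fun w : ℝ × ℝ => (-w.2, p w.1))
    (analyticAt_snd.neg.prod
      (AnalyticAt.fun_comp (x := (t₀, s₀)) (f := fun w : ℝ × ℝ => w.1) hp analyticAt_fst))

theorem exists_analytic_exit {p : ℝ → ℝ × ℝ × ℝ} (hp : AnalyticOnNhd ℝ p (Ici 1))
    (hin : ∀ t, 1 ≤ t → IsInner (p t)) :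
    ∃ τ : ℝ → ℝ, AnalyticOnNhd ℝ τ (Ici 1) ∧
      ∀ t, 1 ≤ t → 0 ≤ τ t ∧ backRadius θ (p t) (τ t) = 1 := by
  choose! σ hσ0 hσ1 using fun t ht => h.exists_exit (hin t ht)
  suffices hloc : ∀ t₀, 1 ≤ t₀ → ∃ g, AnalyticAt ℝ g t₀ ∧ ∀ᶠ t in 𝓝 t₀, 1 ≤ t → σ t = g t by
    obtain ⟨τ, hτ, heq⟩ := exists_analyticOnNhd_Ici hloc
    exact ⟨τ, hτ, fun t ht => by rw [heq t ht]; exact ⟨hσ0 t ht, hσ1 t ht⟩⟩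
  intro t₀ ht₀
  have hback := h.analyticAt_back (hp t₀ ht₀) (hin t₀ ht₀) (hσ0 t₀ ht₀) (hσ1 t₀ ht₀).le
  have hneg := h.radialRate_neg (hin t₀ ht₀) (hσ0 t₀ ht₀) le_rfl (hσ1 t₀ ht₀).le
  have hG : AnalyticAt ℝ (fun w : ℝ × ℝ => backRadius θ (p w.1) w.2) (t₀, σ t₀) :=
    ((analyticAt_fst.fun_comp (analyticAt_snd.fun_comp hback)).pow 2).add
      ((analyticAt_snd.fun_comp (analyticAt_snd.fun_comp hback)).pow 2)
  obtain ⟨ψ, hψ, hψ0, hψG⟩ := exists_analyticAt_implicit hG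
    (h.hasDerivAt_backRadius (p t₀) (σ t₀)) (by linarith)
  refine ⟨ψ, hψ, ?_⟩
  simp only [hσ1 t₀ ht₀] at hψG
  suffices hnn : ∀ᶠ t in 𝓝 t₀, 1 ≤ t → 0 ≤ ψ t by
    filter_upwards [hnn, hψG] with t h1 h2 ht
    exact h.exit_unique (hin t ht) (hσ0 t ht) (h1 ht) (hσ1 t ht) h2
  rcases (hσ0 t₀ ht₀).eq_or_lt with h0 | h0
  · have hev : ∀ᶠ w : ℝ × ℝ in 𝓝 (t₀, σ t₀), radialRate β γ (θ (-w.2) (p w.1)) < 0 :=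
      (h.continuous_radialRate.continuousAt.comp' hback.continuousAt).eventually (gt_mem_nhds hneg)
    rw [← h0, Metric.eventually_nhds_iff_ball] at hev
    obtain ⟨ε, hε, hev⟩ := hev
    rw [← ball_prod_same] at hev
    have hψε : ∀ᶠ t in 𝓝 t₀, ψ t ∈ Metric.ball 0 ε :=
      hψ.continuousAt.eventually (by rw [hψ0, ← h0]; exact Metric.ball_mem_nhds _ hε)
    filter_upwards [hψε, hψG, Metric.ball_mem_nhds t₀ hε] with t h1 h2 h3 ht
    by_contra! hlt
    have hmono : StrictMonoOn (backRadius θ (p t)) (Icc (ψ t) 0) := by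
      refine strictMonoOn_of_hasDerivWithinAt_pos (convex_Icc _ _)
        (fun r _ => (h.hasDerivAt_backRadius (p t) r).continuousAt.continuousWithinAt)
        (fun r _ => (h.hasDerivAt_backRadius (p t) r).hasDerivWithinAt) fun r hr => ?_
      rw [interior_Icc] at hr
      have hr' : r ∈ Metric.ball (0 : ℝ) ε := by
        rw [Real.ball_eq_Ioo] at h1 ⊢
        exact ⟨h1.1.trans hr.1, by linarith [hr.2]⟩
      have := hev (t, r) ⟨h3, hr'⟩
      linarith
    have h4 := hmono (left_mem_Icc.2 hlt.le) (right_mem_Icc.2 hlt.le) hlt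
    rw [h2, h.backRadius_zero] at h4
    linarith [(hin t ht).radius_le]
  · filter_upwards [hψ.continuousAt.eventually (lt_mem_nhds (hψ0 ▸ h0))] with t h1 _
    exact le_of_lt h1

end IsCutoffFlow
end

section
open Topology

/-- The coordinates on the fence `y² + z² = 1`: the inverse of `fencePhiBar`. -/
noncomputable def fenceCoord (q : ℝ × ℝ × ℝ) : ℝ × ℝ := (Real.arcsin q.2.1 / (Real.pi / 2), q.1)

theorem fencePhiBar_fenceCoord {q : ℝ × ℝ × ℝ} (hz : 0 < q.2.2)
    (hq : q.2.1 ^ 2 + q.2.2 ^ 2 = 1) : fencePhiBar (fenceCoord q) = q := by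
  have harg : Real.pi * (Real.arcsin q.2.1 / (Real.pi / 2)) / 2 = Real.arcsin q.2.1 := by
    have := Real.pi_pos
    field_simp
  have hsqrt : √(1 - q.2.1 ^ 2) = q.2.2 := by
    rw [← hq, add_sub_cancel_left, Real.sqrt_sq hz.le]
  simp only [fencePhiBar, fenceCoord, harg, Real.cos_arcsin, hsqrt]
  rw [Real.sin_arcsin (by nlinarith) (by nlinarith)]

theorem fenceCoord_fencePhiBar {w : ℝ × ℝ} (hw : w ∈ fenceSquare) :
    fenceCoord (fencePhiBar w) = w := by
  obtain ⟨⟨h0, h1⟩, -⟩ := hw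
  have hpi := Real.pi_pos
  simp only [fencePhiBar, fenceCoord]
  rw [Real.arcsin_sin (by nlinarith) (by nlinarith)]
  refine Prod.ext ?_ rfl
  simp only
  field_simp

theorem fenceCoord_pos {q : ℝ × ℝ × ℝ} (hx : 0 < q.1) (hy : 0 < q.2.1) :
    0 < (fenceCoord q).1 ∧ 0 < (fenceCoord q).2 :=
  ⟨div_pos (Real.arcsin_pos.2 hy) (by positivity), hx⟩

theorem fenceCoord_mem {q : ℝ × ℝ × ℝ} (hq : q ∈ Bcyl) : fenceCoord q ∈ fenceSquare := by
  obtain ⟨h0, h1, hy, -, -⟩ := hq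
  exact ⟨⟨div_nonneg (Real.arcsin_nonneg.2 hy) (by positivity),
    (div_le_one (by positivity)).2 (Real.arcsin_le_pi_div_two _)⟩, h0, h1⟩

theorem analyticAt_fenceCoord {q : ℝ × ℝ × ℝ} (hy : 0 < q.2.1) (hz : 0 < q.2.2)
    (hq : q.2.1 ^ 2 + q.2.2 ^ 2 = 1) : AnalyticAt ℝ fenceCoord q := by
  have harcsin : AnalyticAt ℝ Real.arcsin q.2.1 :=
    (Real.contDiffAt_arcsin (by linarith) (by nlinarith) (n := ⊤)).analyticAt
  have hsnd : AnalyticAt ℝ (fun q : ℝ × ℝ × ℝ => q.2.1) q := analyticAt_fst.fun_comp analyticAt_snd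
  exact (AnalyticAt.fun_comp (x := q) (f := fun q : ℝ × ℝ × ℝ => q.2.1) harcsin hsnd).div_const.prod
    analyticAt_fst

namespace IsCutoffFlow

variable {ξ : ℝ × ℝ × ℝ → ℝ × ℝ × ℝ} {α β γ : ℝ × ℝ × ℝ → ℝ} {θ : ℝ → ℝ × ℝ × ℝ → ℝ × ℝ × ℝ}
  (h : IsCutoffFlow ξ α β γ θ)
include h

theorem fence_inter_saturation {p : ℝ → ℝ × ℝ × ℝ} {τ : ℝ → ℝ}
    (hin : ∀ t, 1 ≤ t → IsInner (p t)) (hp1 : ∀ t, (p t).1 = 1)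
    (hτ : ∀ t, 1 ≤ t → 0 ≤ τ t ∧ backRadius θ (p t) (τ t) = 1) :
    fenceSquare ∩ fencePhiBar ⁻¹' Saturation ξ (p '' Ici 1) =
      (fun t => fenceCoord (θ (-τ t) (p t))) '' Ici 1 := by
  ext w
  constructor
  · rintro ⟨hw, s₀, s₁, -, δ, hB, hδ, ⟨s, hs, hsw⟩, hA⟩
    have hflow := h.eq_flow δ s₀ s₁ hB hδ
    have hr : (δ s).2.1 ^ 2 + (δ s).2.2 ^ 2 = 1 := by
      rw [hsw]; exact Real.sin_sq_add_cos_sq _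
    obtain ⟨t, ht, r, hr0, hrs⟩ : ∃ t, 1 ≤ t ∧ ∃ r, 0 ≤ r ∧ δ s = θ (-r) (p t) := by
      have hs₁ : s₁ ∈ Icc s₀ s₁ := right_mem_Icc.2 (hs.1.trans hs.2)
      have hs₀ : s₀ ∈ Icc s₀ s₁ := left_mem_Icc.2 (hs.1.trans hs.2)
      rcases hA with ⟨t, ht, hpt⟩ | ⟨t, ht, hpt⟩
      · refine ⟨t, ht, 0, le_rfl, ?_⟩
        suffices s = s₀ by rw [neg_zero, h.zero, this, hpt]
        by_contra hne
        have hlt : s₀ < s := lt_of_le_of_ne hs.1 (Ne.symm hne)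
        have hmono : StrictMonoOn (fun τ => (δ τ).1) (Icc s₀ s) := by
          have hd : ∀ τ ∈ Icc s₀ s, HasDerivAt (fun τ => (δ τ).1) (α (δ τ) * (δ τ).1) τ := by
            intro τ hτ
            have hτ' : τ ∈ Icc s₀ s₁ := ⟨hτ.1, hτ.2.trans hs.2⟩
            have := (hδ τ hτ').hasFDerivAt.fst.hasDerivAt
            rw [h.eq_on _ (hB τ hτ')] at this
            exact this.congr_deriv (by simp)
          refine strictMonoOn_of_hasDerivWithinAt_pos (convex_Icc _ _)
            (fun τ hτ => (hd τ hτ).continuousAt.continuousWithinAt)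
            (fun τ hτ => (hd τ (interior_subset hτ)).hasDerivWithinAt) fun τ hτ => ?_
          have hτ' := interior_subset hτ
          have hτ'' : τ ∈ Icc s₀ s₁ := ⟨hτ'.1, hτ'.2.trans hs.2⟩
          refine mul_pos (h.α_pos _ (hB τ hτ'')) ?_
          rw [hflow τ hτ'', ← hpt]
          exact h.x_pos (hin t ht).x_pos _
        have h1 := hmono (left_mem_Icc.2 hlt.le) (right_mem_Icc.2 hlt.le) hlt
        simp only [← hpt, hp1] at h1
        exact absurd (hB s hs).2.1 (not_le.2 h1)
      · refine ⟨t, ht, s₁ - s, sub_nonneg.2 hs.2, ?_⟩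
        rw [hflow s hs, hpt, hflow s₁ hs₁, ← h.add]
        congr 1
        ring
    have hrτ : r = τ t := h.exit_unique (hin t ht) hr0 (hτ t ht).1
      (by rw [hrs] at hr; exact hr) (hτ t ht).2
    refine ⟨t, ht, ?_⟩
    simp only [← hrτ, ← hrs, hsw]
    exact fenceCoord_fencePhiBar hw
  · rintro ⟨t, ht, rfl⟩
    obtain ⟨hτ0, hτ1⟩ := hτ t ht
    have hB : ∀ s ∈ Icc (-τ t) 0, θ s (p t) ∈ Bcyl := fun s hs => by
      rw [← neg_neg s]
      exact h.mem_Bcyl_of_le (hin t ht) (neg_nonneg.2 hs.2) (by linarith [hs.1] : -s ≤ τ t) hτ1.le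
    refine ⟨fenceCoord_mem (hB _ ⟨le_rfl, by linarith⟩), -τ t, 0, by linarith,
      fun s => θ s (p t), hB, fun s hs => ?_, ⟨-τ t, ⟨le_rfl, by linarith⟩, ?_⟩,
      Or.inr ⟨t, ht, (h.zero _).symm⟩⟩
    · rw [h.eq_on _ (hB s hs)]
      exact h.hasDerivAt _ _
    · exact (fencePhiBar_fenceCoord (h.z_pos (hin t ht).z_pos _) hτ1).symm

theorem deriv_fenceCoord_ne_zero {p : ℝ → ℝ × ℝ × ℝ} {τ : ℝ → ℝ}
    (hin : ∀ t, 1 ≤ t → IsInner (p t)) (hp1 : ∀ t, (p t).1 = 1)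
    (hτa : AnalyticOnNhd ℝ τ (Ici 1))
    (hτ : ∀ t, 1 ≤ t → 0 ≤ τ t ∧ backRadius θ (p t) (τ t) = 1)
    (hE : AnalyticOnNhd ℝ (fun t => fenceCoord (θ (-τ t) (p t))) (Ici 1))
    {t : ℝ} (ht : 1 < t) (hpt : deriv p t ≠ 0) :
    deriv (fun t => fenceCoord (θ (-τ t) (p t))) t ≠ 0 := by
  intro hd0
  have hd : HasDerivAt (fun t => fenceCoord (θ (-τ t) (p t))) 0 t := by
    rw [← hd0]
    exact (hE t ht.le).differentiableAt.hasDerivAt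
  have hexit : HasDerivAt (fun t => θ (-τ t) (p t)) 0 t := by
    have hΦ : DifferentiableAt ℝ fencePhiBar (fenceCoord (θ (-τ t) (p t))) := by
      unfold fencePhiBar
      fun_prop
    have := hΦ.hasFDerivAt.comp_hasDerivAt t hd
    rw [map_zero] at this
    refine this.congr_of_eventuallyEq ?_
    filter_upwards [lt_mem_nhds ht] with r hr
    exact (fencePhiBar_fenceCoord (h.z_pos (hin r hr.le).z_pos _) (hτ r hr.le).2).symm
  have hF : AnalyticAt ℝ (fun w : ℝ × ℝ × ℝ × ℝ => θ w.1 w.2) (τ t, θ (-τ t) (p t)) := by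
    refine h.analyticAt _ _ fun s hs => ?_
    rw [uIcc_of_le (hτ t ht.le).1] at hs
    rw [← h.add, ← neg_neg (s + -τ t)]
    exact h.mem_Bcyl_of_le (hin t ht.le) (by linarith [hs.2])
      (by linarith [hs.1] : -(s + -τ t) ≤ τ t) (hτ t ht.le).2.le
  have hτd := (hτa t ht.le).differentiableAt.hasDerivAt
  have hback : ∀ t, θ (τ t) (θ (-τ t) (p t)) = p t := fun t => by
    rw [← h.add, add_neg_cancel, h.zero]
  have h1 := hF.differentiableAt.hasFDerivAt.comp_hasDerivAt t (hτd.prodMk hexit)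
  have h2 := hF.differentiableAt.hasFDerivAt.comp_hasDerivAt (τ t)
    ((hasDerivAt_id (τ t)).prodMk (hasDerivAt_const (τ t) (θ (-τ t) (p t))))
  have h3 := h2.unique (h.hasDerivAt (θ (-τ t) (p t)) (τ t))
  have h4 : (deriv τ t, (0 : ℝ × ℝ × ℝ)) = deriv τ t • ((1 : ℝ), (0 : ℝ × ℝ × ℝ)) := by simp
  rw [h4, map_smul, h3, hback] at h1
  have h5 : HasDerivAt p (deriv τ t • (α (p t) * (p t).1, β (p t) * (p t).2.1,
      γ (p t) * (p t).2.2)) t := h1.congr_of_eventuallyEq (.of_forall fun t => (hback t).symm)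
  have h6 : deriv τ t * (α (p t) * (p t).1) = 0 := by
    have h7 := h5.hasFDerivAt.fst.hasDerivAt
    have h8 : HasDerivAt (fun t => (p t).1) 0 t := by
      simp only [hp1]
      exact hasDerivAt_const t 1
    simpa using h7.unique h8
  have hα : 0 < α (p t) := by
    refine h.α_pos _ ?_
    have := h.mem_Bcyl_of_le (hin t ht.le) le_rfl (hτ t ht.le).1 (hτ t ht.le).2.le
    simpa [h.zero] using this
  rw [hp1, mul_one] at h6
  refine hpt ?_
  rw [h5.deriv, (mul_eq_zero.1 h6).resolve_right hα.ne', zero_smul]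

end IsCutoffFlow
end

section
open Topology

namespace IsCutoffFlow

variable {ξ : ℝ × ℝ × ℝ → ℝ × ℝ × ℝ} {α β γ : ℝ × ℝ × ℝ → ℝ} {θ : ℝ → ℝ × ℝ × ℝ → ℝ × ℝ × ℝ}
  (h : IsCutoffFlow ξ α β γ θ)
include h

omit h in
variable (α β γ) in
/-- The rate at which `√(y² + z²) - x` increases along backward orbits. -/
noncomputable def escapeRate (p : ℝ × ℝ × ℝ) : ℝ :=
  α p * p.1 - radialRate β γ p / √(p.2.1 ^ 2 + p.2.2 ^ 2)

theorem le_escapeRate {p : ℝ × ℝ × ℝ} (hp : p ∈ Bcyl) (hy : 0 < p.2.1) :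
    α p * p.1 - radialRate β γ p ≤ escapeRate α β γ p := by
  have hr : 0 < p.2.1 ^ 2 + p.2.2 ^ 2 := by positivity
  have hneg : radialRate β γ p < 0 := h.radial_neg p hp hr
  refine sub_le_sub_left ?_ _
  rw [div_le_iff₀ (Real.sqrt_pos.2 hr)]
  have := Real.sqrt_le_one.2 hp.2.2.2.2
  nlinarith

theorem escapeRate_nonneg {p : ℝ × ℝ × ℝ} (hp : p ∈ Bcyl) (hy : 0 < p.2.1) :
    0 ≤ escapeRate α β γ p := by
  refine le_trans ?_ (h.le_escapeRate hp hy)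
  have h1 : radialRate β γ p < 0 := h.radial_neg p hp (by positivity)
  have h2 := mul_nonneg (h.α_pos p hp).le hp.1
  linarith

/-- Near the origin, the escape rate dominates the norm. -/
theorem eventually_norm_le_escapeRate (hα0 : 0 < α 0) (hβ0 : β 0 < 0) (hγ0 : γ 0 < 0) :
    ∃ C, 0 ≤ C ∧ ∀ᶠ p in 𝓝 (0 : ℝ × ℝ × ℝ), p ∈ Bcyl → 0 < p.2.1 →
      ‖p‖ ≤ C * escapeRate α β γ p := by
  obtain ⟨m, hm, hmα, hmβ, hmγ⟩ : ∃ m, 0 < m ∧ m < α 0 ∧ β 0 < -m ∧ γ 0 < -m := by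
    obtain ⟨m, hm, hlt⟩ := exists_between (lt_min hα0 (lt_min (neg_pos.2 hβ0) (neg_pos.2 hγ0)))
    simp only [lt_min_iff] at hlt
    exact ⟨m, hm, hlt.1, lt_neg_of_lt_neg hlt.2.1, lt_neg_of_lt_neg hlt.2.2⟩
  refine ⟨1 / m, by positivity, ?_⟩
  filter_upwards [h.continuous_α.continuousAt.eventually (lt_mem_nhds hmα),
    h.continuous_β.continuousAt.eventually (gt_mem_nhds hmβ),
    h.continuous_γ.continuousAt.eventually (gt_mem_nhds hmγ)] with p h1 h2 h3 hp hy
  have hr : 0 < p.2.1 ^ 2 + p.2.2 ^ 2 := by positivity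
  set r := √(p.2.1 ^ 2 + p.2.2 ^ 2) with hrdef
  have hr0 : 0 < r := Real.sqrt_pos.2 hr
  have hr2 : r ^ 2 = p.2.1 ^ 2 + p.2.2 ^ 2 := Real.sq_sqrt hr.le
  have hnorm : ‖p‖ ≤ p.1 + r := by
    have hyr : |p.2.1| ≤ r := Real.abs_le_sqrt (by linarith [sq_nonneg p.2.2])
    have hzr : |p.2.2| ≤ r := Real.abs_le_sqrt (by linarith [sq_nonneg p.2.1])
    simp only [Prod.norm_def, Real.norm_eq_abs]
    rw [abs_of_nonneg hp.1]
    exact max_le (by linarith) (max_le (by linarith [hp.1]) (by linarith [hp.1]))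
  have hrad : m * r ≤ -(radialRate β γ p / r) := by
    rw [← neg_div, le_div_iff₀ hr0, mul_assoc, ← sq, hr2, radialRate]
    nlinarith [sq_nonneg p.2.1, sq_nonneg p.2.2]
  have hx : m * p.1 ≤ α p * p.1 := mul_le_mul_of_nonneg_right (le_of_lt h1) hp.1
  rw [one_div, inv_mul_eq_div, le_div_iff₀ hm, escapeRate, ← hrdef]
  nlinarith

theorem exists_abs_le_escapeRate (hα0 : 0 < α 0) (hβ0 : β 0 < 0) (hγ0 : γ 0 < 0)
    {f : ℝ × ℝ × ℝ → ℝ} (hf : ContinuousOn f Bcyl) (hf0 : f =O[𝓝 0] fun p => p) :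
    ∃ C, 0 ≤ C ∧ ∀ p ∈ Bcyl, 0 < p.2.1 → |f p| ≤ C * escapeRate α β γ p := by
  obtain ⟨C₁, hC₁, hnear⟩ := h.eventually_norm_le_escapeRate hα0 hβ0 hγ0
  obtain ⟨K, hK, hfK⟩ := hf0.exists_nonneg
  obtain ⟨ε, hε, hball⟩ := Metric.eventually_nhds_iff_ball.1 (hnear.and hfK.bound)
  let S := Bcyl \ Metric.ball 0 ε
  have hS : IsCompact S := isCompact_Bcyl.diff Metric.isOpen_ball
  have hpos : ∀ p ∈ S, 0 < α p * p.1 - radialRate β γ p := by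
    rintro p ⟨hp, hpε⟩
    have hx := mul_nonneg (h.α_pos p hp).le hp.1
    rcases (add_nonneg (sq_nonneg p.2.1) (sq_nonneg p.2.2)).eq_or_lt with h0 | h0
    · have hy : p.2.1 = 0 := by nlinarith [sq_nonneg p.2.1, sq_nonneg p.2.2]
      have hz : p.2.2 = 0 := by nlinarith [sq_nonneg p.2.1, sq_nonneg p.2.2]
      have hx0 : p.1 ≠ 0 := fun hx0 => hpε <| by
        have : p = 0 := Prod.ext hx0 (Prod.ext hy hz)
        rw [this]
        exact Metric.mem_ball_self hε
      have := mul_pos (h.α_pos p hp) (lt_of_le_of_ne hp.1 hx0.symm)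
      simpa [radialRate, hy, hz] using this
    · have : radialRate β γ p < 0 := h.radial_neg p hp h0
      linarith
  obtain ⟨δ, hδ, hfar⟩ : ∃ δ > 0, ∀ p ∈ S, δ ≤ α p * p.1 - radialRate β γ p :=
    hS.exists_forall_le' ((h.continuous_α.mul continuous_fst).sub
      h.continuous_radialRate).continuousOn hpos
  obtain ⟨M, hM⟩ := isCompact_Bcyl.exists_bound_of_continuousOn hf
  have hM0 : 0 ≤ M := (norm_nonneg _).trans (hM 0 (by simp [Bcyl]))
  refine ⟨K * C₁ + M / δ, by positivity, fun p hp hy => ?_⟩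
  have he := h.escapeRate_nonneg hp hy
  rw [← Real.norm_eq_abs, add_mul]
  by_cases hpS : p ∈ Metric.ball 0 ε
  · have h1 := (hball p hpS).1 hp hy
    have h2 := (hball p hpS).2
    have h3 := mul_le_mul_of_nonneg_left h1 hK
    have h4 : 0 ≤ M / δ * escapeRate α β γ p := by positivity
    linarith
  · have h1 := (hfar p ⟨hp, hpS⟩).trans (h.le_escapeRate hp hy)
    have h2 : M ≤ M / δ * escapeRate α β γ p := by
      rw [div_mul_eq_mul_div, le_div_iff₀ hδ]
      exact mul_le_mul_of_nonneg_left h1 hM0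
    have h3 : 0 ≤ K * C₁ * escapeRate α β γ p := by positivity
    linarith [hM p hp]

theorem abs_sub_le_of_escapeRate {p : ℝ × ℝ × ℝ} (hp : IsInner p) {T : ℝ} (hT : 0 ≤ T)
    (hr : backRadius θ p T = 1) {g g' : ℝ → ℝ} {C : ℝ} (hC : 0 ≤ C)
    (hg : ∀ s, HasDerivAt g (g' s) s)
    (hbound : ∀ s ∈ Icc 0 T, |g' s| ≤ C * escapeRate α β γ (θ (-s) p)) :
    |g T - g 0| ≤ 2 * C := by
  let H : ℝ → ℝ := fun s => √(backRadius θ p s) - (θ (-s) p).1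
  have hH : ∀ s, HasDerivAt H (escapeRate α β γ (θ (-s) p)) s := fun s => by
    have hx := (h.hasDerivAt_x p (-s)).scomp s (hasDerivAt_neg s)
    refine (((h.hasDerivAt_backRadius p s).sqrt (h.backRadius_pos hp s).ne').sub hx).congr_deriv ?_
    have : 0 < √(backRadius θ p s) := Real.sqrt_pos.2 (h.backRadius_pos hp s)
    simp only [escapeRate, backRadius] at this ⊢
    simp
    field_simp
    ring
  have hmono : ∀ e : ℝ, |e| = 1 → e * (g T - g 0) ≤ C * (H T - H 0) := by
    intro e he
    have hd : ∀ s, HasDerivAt (fun s => C * H s - e * g s)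
        (C * escapeRate α β γ (θ (-s) p) - e * g' s) s := fun s =>
      ((hH s).const_mul C).sub ((hg s).const_mul e)
    have hm : MonotoneOn (fun s => C * H s - e * g s) (Icc 0 T) := by
      refine monotoneOn_of_hasDerivWithinAt_nonneg (convex_Icc _ _)
        (fun s _ => (hd s).continuousAt.continuousWithinAt)
        (fun s _ => (hd s).hasDerivWithinAt) fun s hs => ?_
      have h1 := hbound s (interior_subset hs)
      have h2 : e * g' s ≤ |g' s| := by
        refine (le_abs_self _).trans ?_
        rw [abs_mul, he, one_mul]
      linarith
    have := hm (left_mem_Icc.2 hT) (right_mem_Icc.2 hT) hT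
    simp only at this
    linarith
  have hHT : H T - H 0 ≤ 2 := by
    have h1 := (h.x_pos hp.x_pos (-T)).le
    have h2 := h.x_le hp.x_pos hp.x_le (le_refl (0 : ℝ))
    have h3 := Real.sqrt_nonneg (backRadius θ p 0)
    simp only [H, hr, Real.sqrt_one]
    linarith
  have h1 := hmono 1 (by simp)
  have h2 := hmono (-1) (by simp)
  have h3 := mul_le_mul_of_nonneg_left hHT hC
  rw [abs_le]
  constructor <;> linarith

theorem abs_log_sub_le {p : ℝ × ℝ × ℝ} (hp : IsInner p) {T : ℝ} (hT : 0 ≤ T)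
    (hr : backRadius θ p T = 1) {w : ℝ → ℝ} {f k : ℝ × ℝ × ℝ → ℝ} {C l : ℝ} (hC : 0 ≤ C)
    (hw : ∀ s, 0 < w s) (hd : ∀ s, HasDerivAt w (k (θ s p) * w s) s)
    (hk : ∀ q ∈ Bcyl, k q = l + f q)
    (hf : ∀ q ∈ Bcyl, 0 < q.2.1 → |f q| ≤ C * escapeRate α β γ q) :
    |Real.log (w (-T)) + l * T - Real.log (w 0)| ≤ 2 * C := by
  have hg : ∀ s, HasDerivAt (fun s => Real.log (w (-s)) + l * s) (-k (θ (-s) p) + l) s := by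
    intro s
    have h1 := ((hd (-s)).log (hw _).ne').scomp s (hasDerivAt_neg s)
    refine (h1.add ((hasDerivAt_id s).const_mul l)).congr_deriv ?_
    have := (hw (-s)).ne'
    simp
    field_simp
  have := h.abs_sub_le_of_escapeRate hp hT hr hC hg fun s hs => by
    have hB := h.mem_Bcyl_of_le hp hs.1 hs.2 hr.le
    rw [hk _ hB, neg_add, neg_add_cancel_comm, abs_neg]
    exact hf _ hB (h.y_pos hp.y_pos _)
  simpa using this

end IsCutoffFlow
end

section
open Topology

theorem curveHasWeight_iff_log {c : ℝ → ℝ × ℝ} (hc : ∀ t, 1 ≤ t → 0 < (c t).1 ∧ 0 < (c t).2)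
    (ρ : ℝ) : CurveHasWeight c ρ ↔
      ∃ K, ∀ᶠ t in atTop, |Real.log (c t).2 - ρ * Real.log (c t).1| ≤ K := by
  constructor
  · rintro ⟨k₁, k₂, t₀, hk₁, hk₂, ht₀, hbound⟩
    refine ⟨max |Real.log k₁| |Real.log k₂|, ?_⟩
    filter_upwards [eventually_gt_atTop t₀] with t ht
    obtain ⟨h1, h2⟩ := hbound t ht
    obtain ⟨hu, hv⟩ := hc t (ht₀.trans ht).le
    have hpow : 0 < (c t).1 ^ ρ := Real.rpow_pos_of_pos hu ρ
    have h3 := Real.log_lt_log (by positivity) h1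
    have h4 := Real.log_lt_log hv h2
    rw [Real.log_mul (by positivity) hpow.ne', Real.log_rpow hu] at h3
    rw [Real.log_mul (by linarith) hpow.ne', Real.log_rpow hu] at h4
    rw [abs_le]
    constructor
    · linarith [neg_abs_le (Real.log k₁), le_max_left |Real.log k₁| |Real.log k₂|]
    · linarith [le_abs_self (Real.log k₂), le_max_right |Real.log k₁| |Real.log k₂|]
  · rintro ⟨K, hK⟩
    obtain ⟨t₁, ht₁⟩ := eventually_atTop.1 hK
    have hK0 : 0 ≤ K := (abs_nonneg _).trans (ht₁ t₁ le_rfl)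
    refine ⟨Real.exp (-(K + 1)), Real.exp (K + 1), max t₁ 2, Real.exp_pos _,
      Real.exp_lt_exp.2 (by linarith), by simp, fun t ht => ?_⟩
    have h1 := abs_le.1 (ht₁ t ((le_max_left _ _).trans ht.le))
    obtain ⟨hu, hv⟩ := hc t (by linarith [le_max_right t₁ 2])
    rw [Real.rpow_def_of_pos hu, ← Real.exp_add, ← Real.exp_add]
    constructor
    · rw [← Real.lt_log_iff_exp_lt hv]
      linarith [h1.1]
    · rw [← Real.log_lt_iff_lt_exp hv]
      linarith [h1.2]

theorem tendsto_zero_of_tendsto_log {ι : Type*} {l : Filter ι} {f : ι → ℝ} (hf : ∀ᶠ t in l, 0 < f t)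
    (h : Tendsto (fun t => Real.log (f t)) l atBot) : Tendsto f l (𝓝 0) :=
  (Real.tendsto_exp_atBot.comp h).congr' (hf.mono fun _ ht => Real.exp_log ht)

theorem abs_log_arcsin_sub_log_le {y : ℝ} (hy : 0 < y) (hy1 : y ≤ 1) :
    |Real.log (Real.arcsin y / (Real.pi / 2)) - Real.log y| ≤ Real.log (Real.pi / 2) := by
  have hpi := Real.pi_pos
  have ha : 0 < Real.arcsin y := Real.arcsin_pos.2 hy
  have hsin : Real.sin (Real.arcsin y) = y := Real.sin_arcsin (by linarith) hy1
  have h1 : Real.log y ≤ Real.log (Real.arcsin y) :=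
    Real.log_le_log hy (hsin.symm.le.trans (Real.sin_le ha.le))
  have h2 : Real.log (Real.arcsin y / (Real.pi / 2)) ≤ Real.log y := by
    refine Real.log_le_log (by positivity) ?_
    have := Real.mul_le_sin ha.le (Real.arcsin_le_pi_div_two y)
    rw [hsin] at this
    calc Real.arcsin y / (Real.pi / 2) = 2 / Real.pi * Real.arcsin y := by field_simp
      _ ≤ y := this
  rw [Real.log_div ha.ne' (by positivity)] at h2 ⊢
  rw [abs_le]
  have h3 : 0 ≤ Real.log (Real.pi / 2) := Real.log_nonneg (by linarith [Real.two_le_pi])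
  constructor <;> linarith

/-- Asymptotics of the exit point `(x, y, z)` of an orbit that enters at `(1, u, v)`, where `T` is
the time the orbit spends near the saddle. -/
theorem exit_asymptotics {ι : Type*} {l : Filter ι} {lam mu ρ D K : ℝ} (hlam : 0 < lam)
    (hmu : 0 < mu) (hρ : 0 < ρ) (hρ' : ρ < mu / lam) {x y z T u v : ι → ℝ}
    (hx0 : ∀ᶠ t in l, 0 < x t) (hy0 : ∀ᶠ t in l, 0 < y t) (hz0 : ∀ᶠ t in l, 0 < z t)
    (hyz : ∀ᶠ t in l, y t ^ 2 + z t ^ 2 = 1)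
    (hv0 : ∀ᶠ t in l, 0 < v t) (hv : Tendsto v l (𝓝 0))
    (huv : ∀ᶠ t in l, |Real.log (v t) - ρ * Real.log (u t)| ≤ K)
    (hx : ∀ᶠ t in l, |Real.log (x t) + T t| ≤ D)
    (hy : ∀ᶠ t in l, |Real.log (y t) - lam * T t - Real.log (u t)| ≤ D)
    (hz : ∀ᶠ t in l, |Real.log (z t) - mu * T t - Real.log (v t)| ≤ D) :
    Tendsto x l (𝓝 0) ∧ Tendsto y l (𝓝 0) ∧
      ∃ M, ∀ᶠ t in l, |Real.log (x t) - ρ / (mu - lam * ρ) * Real.log (y t)| ≤ M := by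
  have hgap : 0 < mu - lam * ρ := by
    rw [lt_div_iff₀ hlam] at hρ'
    linarith
  have hlogv : Tendsto (fun t => Real.log (v t)) l atBot :=
    Real.tendsto_log_nhdsGT_zero.comp (tendsto_nhdsWithin_iff.2 ⟨hv, hv0⟩)
  have hz1 : ∀ᶠ t in l, Real.log (z t) ≤ 0 := by
    filter_upwards [hz0, hyz] with t h1 h2
    exact Real.log_nonpos h1.le (by nlinarith [sq_nonneg (y t)])
  have hy_lim : Tendsto y l (𝓝 0) := by
    refine tendsto_zero_of_tendsto_log hy0 ?_
    have hlim : Tendsto (fun t => (mu - lam * ρ) / (mu * ρ) * Real.log (v t) +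
        (lam * D / mu + K / ρ + D)) l atBot :=
      tendsto_atBot_add_const_right _ _ (hlogv.const_mul_atBot (by positivity))
    refine tendsto_atBot_mono' l ?_ hlim
    filter_upwards [hz1, huv, hy, hz] with t h1 h2 h3 h4
    rw [abs_le] at h2 h3 h4
    have hT : T t ≤ (D - Real.log (v t)) / mu := by
      rw [le_div_iff₀ hmu]
      linarith [h4.1]
    have hu : Real.log (u t) ≤ (Real.log (v t) + K) / ρ := by
      rw [le_div_iff₀ hρ]
      linarith [h2.1]
    have h5 := mul_le_mul_of_nonneg_left hT hlam.le
    calc Real.log (y t) ≤ lam * ((D - Real.log (v t)) / mu) + (Real.log (v t) + K) / ρ + D := by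
          linarith [h3.2]
      _ = _ := by field_simp; ring
  have hz_low : ∀ᶠ t in l, -Real.log 2 ≤ Real.log (z t) := by
    filter_upwards [hz0, hyz, hy0, hy_lim.eventually (gt_mem_nhds (by norm_num : (0 : ℝ) < 1 / 2))]
      with t h1 h2 h3 h4
    rw [← Real.log_inv]
    exact Real.log_le_log (by norm_num) (by nlinarith)
  have hxlim : Tendsto x l (𝓝 0) := by
    refine tendsto_zero_of_tendsto_log hx0 ?_
    have hlim : Tendsto (fun t => 1 / mu * Real.log (v t) + ((D + Real.log 2) / mu + D)) l atBot :=
      tendsto_atBot_add_const_right _ _ (hlogv.const_mul_atBot (by positivity))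
    refine tendsto_atBot_mono' l ?_ hlim
    filter_upwards [hz_low, hz, hx] with t h1 h2 h3
    rw [abs_le] at h2 h3
    have hT : (-Real.log 2 - D - Real.log (v t)) / mu ≤ T t := by
      rw [div_le_iff₀ hmu]
      linarith [h2.2]
    calc Real.log (x t) ≤ D - (-Real.log 2 - D - Real.log (v t)) / mu := by linarith [h3.2]
      _ = _ := by field_simp; ring
  refine ⟨hxlim, hy_lim, (D * (mu - lam * ρ) + K + D + Real.log 2 + ρ * D) / (mu - lam * ρ), ?_⟩
  filter_upwards [hz_low, hz1, huv, hx, hy, hz] with t h1 h2 h3 h4 h5 h6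
  have hfac : Real.log (x t) - ρ / (mu - lam * ρ) * Real.log (y t) =
      ((mu - lam * ρ) * Real.log (x t) - ρ * Real.log (y t)) / (mu - lam * ρ) := by
    rw [sub_div, mul_div_cancel_left₀ _ hgap.ne', mul_div_right_comm]
  rw [hfac, abs_div, abs_of_pos hgap]
  refine div_le_div_of_nonneg_right ?_ hgap.le
  rw [abs_le] at h3 h4 h5 h6 ⊢
  have hA1 := mul_le_mul_of_nonneg_left h4.1 hgap.le
  have hA2 := mul_le_mul_of_nonneg_left h4.2 hgap.le
  have hB1 := mul_le_mul_of_nonneg_left h5.1 hρ.le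
  have hB2 := mul_le_mul_of_nonneg_left h5.2 hρ.le
  have hlog2 := Real.log_nonneg (by norm_num : (1 : ℝ) ≤ 2)
  constructor <;> nlinarith

end

/-- weight transition through a three-dimensional saddle, second case:
if `C'` has weight `ρ' < μ/λ` and `S'` is the saturation of `φₓ(C')` by the
`ξ`-flow in `B`, then `Φ̄⁻¹(S')` lies in the open quadrant and has weight
`ρ'/(μ − λρ')`. -/
theorem weight_transition_second_case
    (lam mu : ℝ) (hlam : 0 < lam) (hmu : 0 < mu)
    (V : Set (ℝ × ℝ × ℝ)) (hVopen : IsOpen V) (hBV : Bcyl ⊆ V)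
    (a b c : ℝ × ℝ × ℝ → ℝ)
    (ha : AnalyticOnNhd ℝ a V) (hb : AnalyticOnNhd ℝ b V) (hc : AnalyticOnNhd ℝ c V)
    (ha0 : a (0, 0, 0) = 0) (hb0 : b (0, 0, 0) = 0) (hc0 : c (0, 0, 0) = 0)
    (ξ : ℝ × ℝ × ℝ → ℝ × ℝ × ℝ)
    (hξ : ∀ p : ℝ × ℝ × ℝ,
      ξ p = ((1 + a p) * p.1, (-lam + b p) * p.2.1, (-mu + c p) * p.2.2))
    (htrans1 : ∀ p ∈ Bcyl, 0 < 1 + a p)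
    (htrans2 : ∀ p ∈ Bcyl, (p.2.1, p.2.2) ≠ ((0 : ℝ), (0 : ℝ)) →
      (-lam + b p) * p.2.1 ^ 2 + (-mu + c p) * p.2.2 ^ 2 < 0)
    (C' : Set (ℝ × ℝ))
    (hC' : C' ⊆ {q : ℝ × ℝ | 0 < q.1 ∧ 0 < q.2 ∧ q.1 ^ 2 + q.2 ^ 2 ≤ 1})
    (ρ' : ℝ) (hρ'pos : 0 < ρ') (hρ' : ρ' < mu / lam) (hw : SetHasWeight C' ρ')
    (S' : Set (ℝ × ℝ × ℝ)) (hS' : S' = Saturation ξ (phiX '' C')) :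
    (fenceSquare ∩ fencePhiBar ⁻¹' S') ⊆ {q : ℝ × ℝ | 0 < q.1 ∧ 0 < q.2} ∧
      SetHasWeight (fenceSquare ∩ fencePhiBar ⁻¹' S') (ρ' / (mu - lam * ρ')) := by
  obtain ⟨α, β, γ, θ, h, hαβγ⟩ := exists_isCutoffFlow lam mu V hVopen hBV a b c ha hb hc ξ hξ
    htrans1 htrans2
  obtain ⟨cu, ⟨hcan, hcpos, hcd, hclim⟩, hcw, rfl⟩ := hw
  set p : ℝ → ℝ × ℝ × ℝ := fun t => phiX (cu t) with hpdef
  have hpan : AnalyticOnNhd ℝ p (Ici 1) := fun t ht => analyticAt_const.prod (hcan t ht)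
  have hin : ∀ t, 1 ≤ t → IsCutoffFlow.IsInner (p t) := fun t ht =>
    ⟨one_pos, le_rfl, (hcpos t ht).1, (hcpos t ht).2, (hC' ⟨t, ht, rfl⟩).2.2⟩
  have hpd : ∀ t, 1 < t → deriv p t ≠ 0 := by
    intro t ht h0
    have h1 : HasDerivAt p 0 t := h0 ▸ (hpan t ht.le).differentiableAt.hasDerivAt
    exact hcd t ht
      ((ContinuousLinearMap.snd ℝ ℝ (ℝ × ℝ)).hasFDerivAt.comp_hasDerivAt t h1).deriv
  obtain ⟨τ, hτan, hτ⟩ := h.exists_analytic_exit hpan hin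
  set q : ℝ → ℝ × ℝ × ℝ := fun t => θ (-τ t) (p t) with hqdef
  have hset : fenceSquare ∩ fencePhiBar ⁻¹' S' = (fun t => fenceCoord (q t)) '' Ici 1 := by
    rw [hS', image_image]
    exact h.fence_inter_saturation hin (fun _ => rfl) hτ
  have hqx : ∀ t, 1 ≤ t → 0 < (q t).1 := fun t ht => h.x_pos (hin t ht).x_pos _
  have hqy : ∀ t, 1 ≤ t → 0 < (q t).2.1 := fun t ht => h.y_pos (hin t ht).y_pos _
  have hqz : ∀ t, 1 ≤ t → 0 < (q t).2.2 := fun t ht => h.z_pos (hin t ht).z_pos _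
  have hqr : ∀ t, 1 ≤ t → (q t).2.1 ^ 2 + (q t).2.2 ^ 2 = 1 := fun t ht => (hτ t ht).2
  have hpos : ∀ t, 1 ≤ t → 0 < (fenceCoord (q t)).1 ∧ 0 < (fenceCoord (q t)).2 := fun t ht =>
    fenceCoord_pos (hqx t ht) (hqy t ht)
  have hdan : AnalyticOnNhd ℝ (fun t => fenceCoord (q t)) (Ici 1) := by
    intro t ht
    have h1 : AnalyticAt ℝ q t :=
      AnalyticAt.fun_comp (x := t) (f := fun t => (t, τ t))
        (h.analyticAt_back (hpan t ht) (hin t ht) (hτ t ht).1 (hτ t ht).2.le)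
        (analyticAt_id.prod (hτan t ht))
    exact (analyticAt_fenceCoord (hqy t ht) (hqz t ht) (hqr t ht)).fun_comp h1
  have h0B : (0 : ℝ × ℝ × ℝ) ∈ Bcyl := by simp [Bcyl]
  have hα0 : 0 < α 0 := h.α_pos 0 h0B
  have hβ0 : β 0 < 0 := by
    rw [(hαβγ 0 h0B).2.1, show b 0 = 0 from hb0]
    linarith
  have hγ0 : γ 0 < 0 := by
    rw [(hαβγ 0 h0B).2.2, show c 0 = 0 from hc0]
    linarith
  have hconst : ∀ f : ℝ × ℝ × ℝ → ℝ, AnalyticOnNhd ℝ f V → f 0 = 0 →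
      ∃ C, 0 ≤ C ∧ ∀ p ∈ Bcyl, 0 < p.2.1 → |f p| ≤ C * IsCutoffFlow.escapeRate α β γ p := by
    intro f hf hf0
    refine h.exists_abs_le_escapeRate hα0 hβ0 hγ0 (hf.continuousOn.mono hBV) ?_
    simpa [hf0] using (hf 0 (hBV h0B)).differentiableAt.isBigO_sub
  obtain ⟨A, hA, hAf⟩ := hconst a ha ha0
  obtain ⟨B, hB, hBf⟩ := hconst b hb hb0
  obtain ⟨C, hC, hCf⟩ := hconst c hc hc0
  have hx : ∀ t, 1 ≤ t → |Real.log (q t).1 + τ t| ≤ 2 * (A + B + C) := by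
    intro t ht
    have h1 := h.abs_log_sub_le (hin t ht) (hτ t ht).1 (hτ t ht).2 hA
      (h.x_pos (hin t ht).x_pos) (h.hasDerivAt_x (p t)) (fun q hq => (hαβγ q hq).1) hAf
    rw [h.zero, show (p t).1 = 1 from rfl, Real.log_one, one_mul, sub_zero] at h1
    linarith
  have hy : ∀ t, 1 ≤ t →
      |Real.log (q t).2.1 - lam * τ t - Real.log (cu t).1| ≤ 2 * (A + B + C) := by
    intro t ht
    have h1 := h.abs_log_sub_le (hin t ht) (hτ t ht).1 (hτ t ht).2 hB
      (h.y_pos (hin t ht).y_pos) (h.hasDerivAt_y (p t)) (fun q hq => (hαβγ q hq).2.1) hBf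
    rw [h.zero, neg_mul, ← sub_eq_add_neg] at h1
    exact h1.trans (by linarith)
  have hz : ∀ t, 1 ≤ t →
      |Real.log (q t).2.2 - mu * τ t - Real.log (cu t).2| ≤ 2 * (A + B + C) := by
    intro t ht
    have h1 := h.abs_log_sub_le (hin t ht) (hτ t ht).1 (hτ t ht).2 hC
      (h.z_pos (hin t ht).z_pos) (h.hasDerivAt_z (p t)) (fun q hq => (hαβγ q hq).2.2) hCf
    rw [h.zero, neg_mul, ← sub_eq_add_neg] at h1
    exact h1.trans (by linarith)
  obtain ⟨K, hK⟩ := (curveHasWeight_iff_log hcpos ρ').1 hcw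
  have hev : ∀ {P : ℝ → Prop}, (∀ t, 1 ≤ t → P t) → ∀ᶠ t in atTop, P t := fun hP =>
    (eventually_ge_atTop 1).mono hP
  obtain ⟨hxlim, hylim, M, hM⟩ := exit_asymptotics hlam hmu hρ'pos hρ' (hev hqx) (hev hqy)
    (hev hqz) (hev hqr) (hev fun t ht => (hcpos t ht).2)
    ((continuous_snd.tendsto _).comp hclim) hK (hev hx) (hev hy) (hev hz)
  rw [hset]
  refine ⟨image_subset_iff.2 hpos, fun t => fenceCoord (q t), ⟨hdan, hpos, fun t ht =>
    h.deriv_fenceCoord_ne_zero hin (fun _ => rfl) hτan hτ hdan ht (hpd t ht), ?_⟩,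
    (curveHasWeight_iff_log hpos _).2 ⟨M + ρ' / (mu - lam * ρ') * Real.log (Real.pi / 2), ?_⟩, rfl⟩
  · refine Tendsto.prodMk_nhds ?_ hxlim
    simpa using ((Real.continuous_arcsin.tendsto _).comp hylim).div_const (Real.pi / 2)
  · have hR : 0 < ρ' / (mu - lam * ρ') := by
      rw [lt_div_iff₀ hlam] at hρ'
      exact div_pos hρ'pos (by linarith)
    filter_upwards [hM, eventually_ge_atTop 1] with t h1 ht
    have h2 := abs_log_arcsin_sub_log_le (hqy t ht)
      (by nlinarith [hqr t ht, hqz t ht, hqy t ht] : (q t).2.1 ≤ 1)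
    calc |Real.log (q t).1 - ρ' / (mu - lam * ρ') * Real.log (fenceCoord (q t)).1|
        = |(Real.log (q t).1 - ρ' / (mu - lam * ρ') * Real.log (q t).2.1) -
            ρ' / (mu - lam * ρ') *
              (Real.log (Real.arcsin (q t).2.1 / (Real.pi / 2)) - Real.log (q t).2.1)| := by
          congr 1
          simp only [fenceCoord]
          ring
      _ ≤ _ := (abs_sub _ _).trans (by
          rw [abs_mul, abs_of_pos hR]
          gcongr)
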